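/- arXiv:2207.05597 — 14 statements merged into one kernel-verified Lean document; each statement's English description precedes it below -/
import Mathlib

section
/- Let x* ∈ B_n. Then x* is a global minimizer of (TRS), i.e. q(x*) ≤ q(x) for all x ∈ B_n, if and only if there exists λ ≥ 0 such that (H + λI)x* + c = 0, λ(x*ᵀx* − 1) = 0, and the matrix H + λI is positive semidefinite. -/
open Matrix

/-- If `a + t * b` is nonnegative for all small `t > 0`, then so is `a`. -/
lemma nonneg_of_forall_small_add_mul {a b δ : ℝ} (hδ : 0 < δ)
    (h : ∀ t, 0 < t → t ≤ δ → 0 ≤ a + t * b) : 0 ≤ a := by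
  by_contra! ha
  have hb : 0 < |b| + 1 := by positivity
  have ht : 0 < min δ (-a / (2 * (|b| + 1))) :=
    lt_min hδ (div_pos (by linarith) (by positivity))
  have h₁ := h _ ht (min_le_left _ _)
  have h₂ := min_le_right δ (-a / (2 * (|b| + 1)))
  rw [le_div_iff₀ (by positivity)] at h₂
  nlinarith [mul_le_mul_of_nonneg_left (le_abs_self b) ht.le]

/-- Exact second-order expansion of a quadratic function with symmetric Hessian. -/
lemma quadratic_add_eq {n : ℕ} {H : Matrix (Fin n) (Fin n) ℝ} (hH : H.IsSymm)
    (c x d : Fin n → ℝ) :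
    (1 / 2) * ((x + d) ⬝ᵥ (H *ᵥ (x + d))) + c ⬝ᵥ (x + d) =
      ((1 / 2) * (x ⬝ᵥ (H *ᵥ x)) + c ⬝ᵥ x) + (H *ᵥ x + c) ⬝ᵥ d
        + (1 / 2) * (d ⬝ᵥ (H *ᵥ d)) := by
  have h₁ : x ⬝ᵥ (H *ᵥ d) = (H *ᵥ x) ⬝ᵥ d := by
    rw [dotProduct_mulVec, ← mulVec_transpose, hH.eq]
  have h₂ : d ⬝ᵥ (H *ᵥ x) = (H *ᵥ x) ⬝ᵥ d := dotProduct_comm _ _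
  simp only [mulVec_add, add_dotProduct, dotProduct_add, h₁, h₂]
  ring

lemma dotProduct_add_smul_one_mulVec {n : ℕ} (H : Matrix (Fin n) (Fin n) ℝ) (r : ℝ)
    (w : Fin n → ℝ) :
    w ⬝ᵥ ((H + r • (1 : Matrix (Fin n) (Fin n) ℝ)) *ᵥ w) =
      w ⬝ᵥ (H *ᵥ w) + r * (w ⬝ᵥ w) := by
  simp [add_mulVec, smul_mulVec]

lemma dotProduct_self_nonneg_real {n : ℕ} (v : Fin n → ℝ) : 0 ≤ v ⬝ᵥ v :=
  Finset.sum_nonneg fun i _ => mul_self_nonneg (v i)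

lemma dotProduct_add_self {n : ℕ} (x d : Fin n → ℝ) :
    (x + d) ⬝ᵥ (x + d) = x ⬝ᵥ x + 2 * (x ⬝ᵥ d) + d ⬝ᵥ d := by
  simp only [add_dotProduct, dotProduct_add, dotProduct_comm d x]
  ring

/-- First-order condition along directions that stay in the unit ball for a short time. -/
lemma gradient_dotProduct_nonneg {n : ℕ} {H : Matrix (Fin n) (Fin n) ℝ} {g x : Fin n → ℝ}
    (h : ∀ d : Fin n → ℝ, x ⬝ᵥ x + 2 * (x ⬝ᵥ d) + d ⬝ᵥ d ≤ 1 →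
      0 ≤ g ⬝ᵥ d + (1 / 2) * (d ⬝ᵥ (H *ᵥ d)))
    {d : Fin n → ℝ} {δ : ℝ} (hδ : 0 < δ)
    (hd : ∀ t, 0 < t → t ≤ δ → x ⬝ᵥ x + t * (2 * (x ⬝ᵥ d) + t * (d ⬝ᵥ d)) ≤ 1) :
    0 ≤ g ⬝ᵥ d := by
  refine nonneg_of_forall_small_add_mul (b := (1 / 2) * (d ⬝ᵥ (H *ᵥ d))) hδ fun t ht htδ => ?_
  have := h (t • d) (by
    have := hd t ht htδ
    simp only [smul_dotProduct, dotProduct_smul, smul_eq_mul]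
    linarith)
  simp only [mulVec_smul, smul_dotProduct, dotProduct_smul, smul_eq_mul] at this
  refine nonneg_of_mul_nonneg_right (a := t) ?_ ht
  linarith

lemma interior_optimality {n : ℕ} {H : Matrix (Fin n) (Fin n) ℝ} {g x : Fin n → ℝ}
    (hx : x ⬝ᵥ x < 1)
    (h : ∀ d : Fin n → ℝ, x ⬝ᵥ x + 2 * (x ⬝ᵥ d) + d ⬝ᵥ d ≤ 1 →
      0 ≤ g ⬝ᵥ d + (1 / 2) * (d ⬝ᵥ (H *ᵥ d))) :
    g = 0 ∧ ∀ w : Fin n → ℝ, 0 ≤ w ⬝ᵥ (H *ᵥ w) := by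
  have small (d : Fin n → ℝ) : ∃ δ > 0, ∀ t, 0 < t → t ≤ δ →
      x ⬝ᵥ x + t * (2 * (x ⬝ᵥ d) + t * (d ⬝ᵥ d)) ≤ 1 := by
    have hdd := dotProduct_self_nonneg_real d
    have hpos : 0 < 2 * |x ⬝ᵥ d| + d ⬝ᵥ d + 1 := by positivity
    refine ⟨min 1 ((1 - x ⬝ᵥ x) / (2 * |x ⬝ᵥ d| + d ⬝ᵥ d + 1)),
      lt_min one_pos (div_pos (by linarith) hpos), fun t ht htδ => ?_⟩
    have h₁ := htδ.trans (min_le_left _ _)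
    have h₂ := htδ.trans (min_le_right _ _)
    rw [le_div_iff₀ hpos] at h₂
    have h₃ : 2 * (x ⬝ᵥ d) + t * (d ⬝ᵥ d) ≤ 2 * |x ⬝ᵥ d| + d ⬝ᵥ d + 1 := by
      nlinarith [le_abs_self (x ⬝ᵥ d), mul_le_mul_of_nonneg_right h₁ hdd]
    linarith [mul_le_mul_of_nonneg_left h₃ ht.le]
  have hg : g = 0 := by
    obtain ⟨δ, hδ, hsm⟩ := small (-g)
    have := gradient_dotProduct_nonneg h hδ hsm
    rw [dotProduct_neg] at this
    exact dotProduct_self_eq_zero.mp (by linarith [dotProduct_self_nonneg_real g])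
  refine ⟨hg, fun w => ?_⟩
  obtain ⟨δ, hδ, hsm⟩ := small w
  have := h (δ • w) (by
    have := hsm δ hδ le_rfl
    simp only [smul_dotProduct, dotProduct_smul, smul_eq_mul]
    linarith)
  simp only [hg, zero_dotProduct, mulVec_smul, smul_dotProduct, dotProduct_smul,
    smul_eq_mul] at this
  refine nonneg_of_mul_nonneg_right (a := δ * δ) ?_ (by positivity)
  linarith

lemma boundary_optimality {n : ℕ} {H : Matrix (Fin n) (Fin n) ℝ} {g x : Fin n → ℝ}
    (hx : x ⬝ᵥ x = 1)
    (h : ∀ d : Fin n → ℝ, x ⬝ᵥ x + 2 * (x ⬝ᵥ d) + d ⬝ᵥ d ≤ 1 →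
      0 ≤ g ⬝ᵥ d + (1 / 2) * (d ⬝ᵥ (H *ᵥ d))) :
    ∃ r : ℝ, 0 ≤ r ∧ g + r • x = 0 ∧
      ∀ w : Fin n → ℝ, 0 ≤ w ⬝ᵥ (H *ᵥ w) + r * (w ⬝ᵥ w) := by
  have inward (d : Fin n → ℝ) (hd : x ⬝ᵥ d < 0) : 0 ≤ g ⬝ᵥ d := by
    have hdd := dotProduct_self_nonneg_real d
    refine gradient_dotProduct_nonneg h
      (δ := -(2 * (x ⬝ᵥ d)) / (d ⬝ᵥ d + 1)) (div_pos (by linarith) (by linarith)) ?_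
    intro t ht htδ
    rw [le_div_iff₀ (by linarith)] at htδ
    have : 2 * (x ⬝ᵥ d) + t * (d ⬝ᵥ d) ≤ 0 := by linarith
    linarith [mul_nonpos_of_nonneg_of_nonpos ht.le this]
  have hr : 0 ≤ -(g ⬝ᵥ x) := by
    simpa using inward (-x) (by simp [hx])
  have hg : g + (-(g ⬝ᵥ x)) • x = 0 := by
    set p : Fin n → ℝ := g + (-(g ⬝ᵥ x)) • x with hp
    have hxp : x ⬝ᵥ p = 0 := by
      simp [hp, dotProduct_add, dotProduct_smul, hx, dotProduct_comm x g]
    have hgp : g ⬝ᵥ p = p ⬝ᵥ p := by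
      have : p ⬝ᵥ p = (g + (-(g ⬝ᵥ x)) • x) ⬝ᵥ p := rfl
      simp [this, add_dotProduct, smul_dotProduct, hxp]
    have : 0 ≤ -(p ⬝ᵥ p) := by
      refine nonneg_of_forall_small_add_mul (b := -(g ⬝ᵥ x)) one_pos fun t ht _ => ?_
      have := inward (-p + (-t) • x) (by
        simp only [dotProduct_add, dotProduct_neg, dotProduct_smul, hxp, hx, smul_eq_mul]
        linarith)
      simp only [dotProduct_add, dotProduct_neg, dotProduct_smul, hgp, smul_eq_mul] at this
      linarith
    exact dotProduct_self_eq_zero.mp (by linarith [dotProduct_self_nonneg_real p])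
  refine ⟨-(g ⬝ᵥ x), hr, hg, ?_⟩
  set r := -(g ⬝ᵥ x)
  have hgd (d : Fin n → ℝ) : g ⬝ᵥ d = -(r * (x ⬝ᵥ d)) := by
    rw [eq_neg_of_add_eq_zero_left hg, neg_dotProduct, smul_dotProduct, smul_eq_mul]
  have transversal (w : Fin n → ℝ) (hw : x ⬝ᵥ w ≠ 0) :
      0 ≤ w ⬝ᵥ (H *ᵥ w) + r * (w ⬝ᵥ w) := by
    have hww : w ⬝ᵥ w ≠ 0 := fun h0 => hw (by simp [dotProduct_self_eq_zero.mp h0])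
    obtain ⟨t, ht, htw⟩ : ∃ t : ℝ, t ≠ 0 ∧ t * (w ⬝ᵥ w) = -(2 * (x ⬝ᵥ w)) :=
      ⟨-(2 * (x ⬝ᵥ w)) / (w ⬝ᵥ w), div_ne_zero (by simpa using hw) hww,
        div_mul_cancel₀ _ hww⟩
    have := h (t • w) (by
      simp only [smul_dotProduct, dotProduct_smul, smul_eq_mul, htw, hx]
      linarith)
    simp only [hgd, mulVec_smul, smul_dotProduct, dotProduct_smul, smul_eq_mul] at this
    refine nonneg_of_mul_nonneg_right (a := t * t) ?_ (mul_self_pos.mpr ht)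
    linear_combination 2 * this - r * t * htw
  intro w
  by_cases hw : x ⬝ᵥ w = 0
  · refine nonneg_of_forall_small_add_mul (b := w ⬝ᵥ (H *ᵥ x) + x ⬝ᵥ (H *ᵥ w)
      + |x ⬝ᵥ (H *ᵥ x) + r|) one_pos fun t ht ht1 => ?_
    have := transversal (w + t • x) (by
      simpa [dotProduct_add, dotProduct_smul, hw, hx] using ht.ne')
    simp only [mulVec_add, mulVec_smul, add_dotProduct, dotProduct_add, smul_dotProduct,
      dotProduct_smul, dotProduct_comm w x, hw, hx, smul_eq_mul] at this
    have h₁ : t * (x ⬝ᵥ (H *ᵥ x) + r) ≤ |x ⬝ᵥ (H *ᵥ x) + r| :=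
      (mul_le_mul_of_nonneg_left (le_abs_self _) ht.le).trans
        (mul_le_of_le_one_left (abs_nonneg _) ht1)
    linarith [mul_le_mul_of_nonneg_left h₁ ht.le]
  · exact transversal w hw

/-- Necessary and sufficient global optimality condition for the trust region
subproblem (TRS): `x*` minimizes `q(x) = (1/2)xᵀHx + cᵀx` over the unit ball iff
there is `λ ≥ 0` with `(H + λI)x* + c = 0`, `λ(x*ᵀx* − 1) = 0`, and `H + λI ⪰ 0`. -/
theorem stmt_0 {n : ℕ} (H : Matrix (Fin n) (Fin n) ℝ) (hH : H.IsSymm)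
    (c : Fin n → ℝ) (q : (Fin n → ℝ) → ℝ)
    (hq : ∀ x, q x = (1 / 2) * (x ⬝ᵥ (H *ᵥ x)) + c ⬝ᵥ x)
    (xs : Fin n → ℝ) (hxs : xs ⬝ᵥ xs ≤ 1) :
    (∀ x : Fin n → ℝ, x ⬝ᵥ x ≤ 1 → q xs ≤ q x) ↔
      ∃ lam : ℝ, 0 ≤ lam ∧
        (H + lam • (1 : Matrix (Fin n) (Fin n) ℝ)) *ᵥ xs + c = 0 ∧
        lam * (xs ⬝ᵥ xs - 1) = 0 ∧
        ∀ w : Fin n → ℝ,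
          0 ≤ w ⬝ᵥ ((H + lam • (1 : Matrix (Fin n) (Fin n) ℝ)) *ᵥ w) := by
  have grad (r : ℝ) : (H + r • (1 : Matrix (Fin n) (Fin n) ℝ)) *ᵥ xs + c =
      (H *ᵥ xs + c) + r • xs := by
    simp only [add_mulVec, smul_mulVec, one_mulVec]
    abel
  simp only [grad, dotProduct_add_smul_one_mulVec]
  constructor
  · intro hmin
    have h (d : Fin n → ℝ) (hd : xs ⬝ᵥ xs + 2 * (xs ⬝ᵥ d) + d ⬝ᵥ d ≤ 1) :
        0 ≤ (H *ᵥ xs + c) ⬝ᵥ d + (1 / 2) * (d ⬝ᵥ (H *ᵥ d)) := by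
      have := hmin (xs + d) (by rwa [dotProduct_add_self])
      rw [hq, hq, quadratic_add_eq hH] at this
      linarith
    rcases hxs.lt_or_eq with hlt | heq
    · obtain ⟨hg, hpsd⟩ := interior_optimality hlt h
      exact ⟨0, le_rfl, by simp [hg], by simp, by simpa using hpsd⟩
    · obtain ⟨r, hr, hg, hpsd⟩ := boundary_optimality heq h
      exact ⟨r, hr, hg, by simp [heq], hpsd⟩
  · rintro ⟨r, hr, hg, hcomp, hpsd⟩ x hx
    obtain ⟨d, rfl⟩ : ∃ d, x = xs + d := ⟨x - xs, by simp⟩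
    rw [hq, hq, quadratic_add_eq hH, eq_neg_of_add_eq_zero_left hg, neg_dotProduct,
      smul_dotProduct, smul_eq_mul]
    rw [dotProduct_add_self] at hx
    linarith [hpsd d, mul_le_mul_of_nonneg_left hx hr]
end

section
/- The minimum of q(x) over x ∈ B_n equals the minimum of (1/2)xᵀHx + (1/2)yᵀHy + cᵀx over all pairs (x, y) ∈ ℝⁿ × ℝⁿ with xᵀx + yᵀy ≤ 1. -/
open Matrix

/-- If `S ⊆ T` and every element of `T` dominates an element of `S`, the infima agree. -/
theorem Real.sInf_eq_of_subset_of_forall_exists_le {S T : Set ℝ} (hST : S ⊆ T)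
    (hTS : ∀ t ∈ T, ∃ s ∈ S, s ≤ t) : sInf S = sInf T := by
  have hlb : lowerBounds S = lowerBounds T := by
    refine Set.Subset.antisymm (fun b hb t ht => ?_) (lowerBounds_mono_set hST)
    obtain ⟨s, hs, hst⟩ := hTS t ht
    exact (hb hs).trans hst
  rcases S.eq_empty_or_nonempty with rfl | hS
  · have hT : T = ∅ := Set.eq_empty_of_forall_notMem fun t ht => by
      obtain ⟨s, hs, -⟩ := hTS t ht
      exact hs
    rw [hT]
  by_cases hb : BddBelow S
  · have h := isGLB_csInf hS hb
    rw [IsGLB, hlb] at h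
    exact (IsGLB.csInf_eq h (hS.mono hST)).symm
  · have hb' : ¬ BddBelow T := by rwa [BddBelow, ← hlb]
    rw [Real.sInf_of_not_bddBelow hb, Real.sInf_of_not_bddBelow hb']

/-- A positive `t` for which `t` and `-t⁻¹` both lie in the sublevel set
`{r | a * r ^ 2 + 2 * b * r ≤ d}`. -/
theorem exists_pos_quadratic_le {a d : ℝ} (b : ℝ) (ha : 0 < a) (had : a ≤ d) :
    ∃ t : ℝ, 0 < t ∧ a * t ^ 2 + 2 * b * t ≤ d ∧
      a * (-t⁻¹) ^ 2 + 2 * b * (-t⁻¹) ≤ d := by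
  have hD : 0 ≤ b ^ 2 + a * d := by nlinarith
  have hbr : b < √(b ^ 2 + a * d) := Real.lt_sqrt_of_sq_lt (by nlinarith)
  set r := √(b ^ 2 + a * d)
  have hr : r ^ 2 = b ^ 2 + a * d := Real.sq_sqrt hD
  have ht : 0 < (r - b) / a := div_pos (by linarith) ha
  have hroot : a * ((r - b) / a) ^ 2 + 2 * b * ((r - b) / a) = d := by
    field_simp
    linarith
  refine ⟨(r - b) / a, ht, hroot.le, ?_⟩
  generalize (r - b) / a = t at ht hroot
  have h : a * (-t⁻¹) ^ 2 + 2 * b * (-t⁻¹) - d = (a - d) * (1 + t ^ 2) / t ^ 2 := by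
    rw [← hroot]
    field_simp
    ring
  have h' : (a - d) * (1 + t ^ 2) / t ^ 2 ≤ 0 :=
    div_nonpos_of_nonpos_of_nonneg
      (mul_nonpos_of_nonpos_of_nonneg (by linarith) (by positivity)) (by positivity)
  linarith

/-- Some point of the unit ball on the line `x + ℝ y` has objective value at most that of
the pair `(x, y)`. -/
theorem exists_quadratic_le_of_pair {n : ℕ} (H : Matrix (Fin n) (Fin n) ℝ)
    (c x y : Fin n → ℝ) (hxy : x ⬝ᵥ x + y ⬝ᵥ y ≤ 1) :
    ∃ z : Fin n → ℝ, z ⬝ᵥ z ≤ 1 ∧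
      (1 / 2) * (z ⬝ᵥ (H *ᵥ z)) + c ⬝ᵥ z ≤
        (1 / 2) * (x ⬝ᵥ (H *ᵥ x)) + (1 / 2) * (y ⬝ᵥ (H *ᵥ y)) + c ⬝ᵥ x := by
  by_cases hy : y = 0
  · subst hy
    exact ⟨x, by simpa using hxy, by simp⟩
  have ha : 0 < y ⬝ᵥ y :=
    lt_of_le_of_ne (Finset.sum_nonneg fun i _ => mul_self_nonneg (y i))
      (Ne.symm (mt dotProduct_self_eq_zero.1 hy))
  have hnorm (r : ℝ) : (x + r • y) ⬝ᵥ (x + r • y) =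
      x ⬝ᵥ x + ((y ⬝ᵥ y) * r ^ 2 + 2 * (x ⬝ᵥ y) * r) := by
    simp only [dotProduct_add, add_dotProduct, smul_dotProduct, dotProduct_smul, smul_eq_mul,
      dotProduct_comm y x]
    ring
  have hval (r : ℝ) : (1 / 2) * ((x + r • y) ⬝ᵥ (H *ᵥ (x + r • y))) + c ⬝ᵥ (x + r • y) =
      (1 / 2) * (x ⬝ᵥ (H *ᵥ x)) + c ⬝ᵥ x +
        r * ((1 / 2) * (x ⬝ᵥ (H *ᵥ y) + y ⬝ᵥ (H *ᵥ x)) + c ⬝ᵥ y) +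
        r ^ 2 * ((1 / 2) * (y ⬝ᵥ (H *ᵥ y))) := by
    simp only [mulVec_add, mulVec_smul, dotProduct_add, add_dotProduct, smul_dotProduct,
      dotProduct_smul, smul_eq_mul]
    ring
  obtain ⟨t, ht, h₁, h₂⟩ :=
    exists_pos_quadratic_le (d := 1 - x ⬝ᵥ x) (x ⬝ᵥ y) ha (by linarith)
  by_contra! hlt
  have k₁ := hlt (x + t • y) (by rw [hnorm]; linarith)
  have k₂ := hlt (x + (-t⁻¹) • y) (by rw [hnorm]; linarith)
  rw [hval] at k₁ k₂
  generalize (1 / 2) * (x ⬝ᵥ (H *ᵥ y) + y ⬝ᵥ (H *ᵥ x)) + c ⬝ᵥ y = L at k₁ k₂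
  generalize (1 / 2) * (y ⬝ᵥ (H *ᵥ y)) = Q at k₁ k₂
  have m₁ : 0 < t * L + (t ^ 2 - 1) * Q := by linarith
  have m₂ : 0 < (-t⁻¹) * L + ((-t⁻¹) ^ 2 - 1) * Q := by linarith
  have m₃ : t ^ 2 * ((-t⁻¹) * L + ((-t⁻¹) ^ 2 - 1) * Q) = -(t * L + (t ^ 2 - 1) * Q) := by
    field_simp
    ring
  have m₄ := mul_pos (pow_pos ht 2) m₂
  linarith

/-- The minimum of `q(x) = (1/2)xᵀHx + cᵀx` over the unit ball `B_n` equals the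
minimum of `(1/2)xᵀHx + (1/2)yᵀHy + cᵀx` over `{(x,y) : xᵀx + yᵀy ≤ 1}`. -/
theorem stmt_1 {n : ℕ} (H : Matrix (Fin n) (Fin n) ℝ) (hH : H.IsSymm)
    (c : Fin n → ℝ) :
    sInf ((fun x : Fin n → ℝ => (1 / 2) * (x ⬝ᵥ (H *ᵥ x)) + c ⬝ᵥ x) ''
        {x : Fin n → ℝ | x ⬝ᵥ x ≤ 1}) =
      sInf ((fun p : (Fin n → ℝ) × (Fin n → ℝ) =>
          (1 / 2) * (p.1 ⬝ᵥ (H *ᵥ p.1)) + (1 / 2) * (p.2 ⬝ᵥ (H *ᵥ p.2)) + c ⬝ᵥ p.1) ''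
        {p : (Fin n → ℝ) × (Fin n → ℝ) | p.1 ⬝ᵥ p.1 + p.2 ⬝ᵥ p.2 ≤ 1}) := by
  refine Real.sInf_eq_of_subset_of_forall_exists_le ?_ ?_
  · rintro _ ⟨x, hx, rfl⟩
    exact ⟨(x, 0), by simpa using hx, by simp⟩
  · rintro _ ⟨⟨x, y⟩, hxy, rfl⟩
    obtain ⟨z, hz, hle⟩ := exists_quadratic_le_of_pair H c x y hxy
    exact ⟨_, ⟨z, hz, rfl⟩, hle⟩
end

section
/- Suppose (x̃, ỹ) ∈ ℝⁿ × ℝⁿ with x̃ᵀx̃ + ỹᵀỹ ≤ 1 is a global minimizer of (1/2)xᵀHx + (1/2)yᵀHy + cᵀx over {(x, y) : xᵀx + yᵀy ≤ 1}, and ỹ ≠ 0. Then (H − λ₁I)x̃ + c = 0, x̃ᵀx̃ < 1, and the point x* = x̃ + θỹ with θ = (√((x̃ᵀỹ)² + (ỹᵀỹ)(1 − x̃ᵀx̃)) − x̃ᵀỹ)/(ỹᵀỹ) satisfies x*ᵀx* = 1 and is a global minimizer of (TRS), i.e. q(x*) ≤ q(x) for all x ∈ B_n. -/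
open Matrix

/-- Expansion of a quadratic function of a symmetric matrix along a line. -/
lemma Matrix.IsSymm.quadratic_add_smul {n : ℕ} {H : Matrix (Fin n) (Fin n) ℝ} (hH : H.IsSymm)
    (x d : Fin n → ℝ) (e : ℝ) :
    (x + e • d) ⬝ᵥ (H *ᵥ (x + e • d)) =
      x ⬝ᵥ (H *ᵥ x) + 2 * e * (d ⬝ᵥ (H *ᵥ x)) + e ^ 2 * (d ⬝ᵥ (H *ᵥ d)) := by
  have hxd : x ⬝ᵥ (H *ᵥ d) = d ⬝ᵥ (H *ᵥ x) := by
    rw [dotProduct_mulVec, ← mulVec_transpose, hH.eq, dotProduct_comm]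
  simp only [mulVec_add, mulVec_smul, add_dotProduct, dotProduct_add, smul_dotProduct,
    dotProduct_smul, smul_eq_mul, hxd]
  ring

/-- Expansion of the squared Euclidean length along a line. -/
lemma dotProduct_self_add_smul {n : ℕ} (x d : Fin n → ℝ) (e : ℝ) :
    (x + e • d) ⬝ᵥ (x + e • d) = x ⬝ᵥ x + 2 * e * (d ⬝ᵥ x) + e ^ 2 * (d ⬝ᵥ d) := by
  simpa using (isSymm_one (n := Fin n) (α := ℝ)).quadratic_add_smul x d e

/-- A nonzero real vector can be rescaled to any prescribed nonnegative squared length. -/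
lemma exists_smul_dotProduct_self_eq {n : ℕ} {v : Fin n → ℝ} (hv : v ≠ 0) {r : ℝ} (hr : 0 ≤ r) :
    ∃ a : ℝ, (a • v) ⬝ᵥ (a • v) = r := by
  have hvv : v ⬝ᵥ v ≠ 0 := fun h => hv (dotProduct_self_eq_zero.mp h)
  have hpos : 0 ≤ v ⬝ᵥ v := by simpa using dotProduct_star_self_nonneg v
  refine ⟨√(r / (v ⬝ᵥ v)), ?_⟩
  rw [smul_dotProduct, dotProduct_smul, smul_eq_mul, smul_eq_mul, ← mul_assoc,
    Real.mul_self_sqrt (div_nonneg hr hpos), div_mul_cancel₀ _ hvv]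

/-- If a real quadratic polynomial has a local minimum at zero, its linear coefficient vanishes. -/
lemma linear_coeff_eq_zero_of_eventually_nonneg {b k : ℝ}
    (h : ∀ᶠ e in nhds (0 : ℝ), 0 ≤ e * b + e ^ 2 * k) : b = 0 := by
  have hder : HasDerivAt (fun e : ℝ => e * b + e ^ 2 * k) b 0 := by
    simpa using ((hasDerivAt_id' (0 : ℝ)).mul_const b).fun_add
      (((hasDerivAt_id' (0 : ℝ)).fun_pow 2).mul_const k)
  refine IsLocalMin.hasDerivAt_eq_zero ?_ hder
  filter_upwards [h] with e he
  simpa using he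

/-- If `(x̃, ỹ)` is a global minimizer of `(1/2)xᵀHx + (1/2)yᵀHy + cᵀx` over
`{(x,y) : xᵀx + yᵀy ≤ 1}` and `ỹ ≠ 0`, then `(H − λ₁I)x̃ + c = 0`, `x̃ᵀx̃ < 1`,
and `x* = x̃ + θỹ` with
`θ = (√((x̃ᵀỹ)² + (ỹᵀỹ)(1 − x̃ᵀx̃)) − x̃ᵀỹ)/(ỹᵀỹ)` satisfies `x*ᵀx* = 1` and is a
global minimizer of (TRS). Here `λ₁` is the smallest eigenvalue of the symmetric
matrix `H`, characterized by having an eigenvector and the Rayleigh bound. -/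
theorem stmt_3 {n : ℕ} (H : Matrix (Fin n) (Fin n) ℝ) (hH : H.IsSymm)
    (c : Fin n → ℝ) (q : (Fin n → ℝ) → ℝ)
    (hq : ∀ x, q x = (1 / 2) * (x ⬝ᵥ (H *ᵥ x)) + c ⬝ᵥ x)
    (lam1 : ℝ) (hev : ∃ v : Fin n → ℝ, v ≠ 0 ∧ H *ᵥ v = lam1 • v)
    (hray : ∀ x : Fin n → ℝ, lam1 * (x ⬝ᵥ x) ≤ x ⬝ᵥ (H *ᵥ x))
    (xt yt : Fin n → ℝ) (hfeas : xt ⬝ᵥ xt + yt ⬝ᵥ yt ≤ 1)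
    (hmin : ∀ x y : Fin n → ℝ, x ⬝ᵥ x + y ⬝ᵥ y ≤ 1 →
      (1 / 2) * (xt ⬝ᵥ (H *ᵥ xt)) + (1 / 2) * (yt ⬝ᵥ (H *ᵥ yt)) + c ⬝ᵥ xt ≤
        (1 / 2) * (x ⬝ᵥ (H *ᵥ x)) + (1 / 2) * (y ⬝ᵥ (H *ᵥ y)) + c ⬝ᵥ x)
    (hy : yt ≠ 0)
    (θ : ℝ)
    (hθ : θ = (Real.sqrt ((xt ⬝ᵥ yt) ^ 2 + (yt ⬝ᵥ yt) * (1 - xt ⬝ᵥ xt)) - xt ⬝ᵥ yt) /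
      (yt ⬝ᵥ yt)) :
    (H - lam1 • (1 : Matrix (Fin n) (Fin n) ℝ)) *ᵥ xt + c = 0 ∧
      xt ⬝ᵥ xt < 1 ∧
      (xt + θ • yt) ⬝ᵥ (xt + θ • yt) = 1 ∧
      ∀ x : Fin n → ℝ, x ⬝ᵥ x ≤ 1 → q (xt + θ • yt) ≤ q x := by
  obtain ⟨v, hv, hHv⟩ := hev
  have ht : 0 < yt ⬝ᵥ yt :=
    lt_of_le_of_ne (by simpa using dotProduct_star_self_nonneg yt)
      fun h => hy (dotProduct_self_eq_zero.mp h.symm)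
  have hval : ∀ a : ℝ, (a • v) ⬝ᵥ (H *ᵥ (a • v)) = lam1 * ((a • v) ⬝ᵥ (a • v)) := fun a => by
    rw [mulVec_smul, hHv, smul_comm, dotProduct_smul, smul_eq_mul]
  have hyray := hray yt
  have hlam : lam1 ≤ 0 := by
    have := hmin xt 0 (by simp; linarith)
    simp only [mulVec_zero, dotProduct_zero] at this
    by_contra! hl
    nlinarith [mul_pos hl ht]
  have hyH : yt ⬝ᵥ (H *ᵥ yt) = lam1 * (yt ⬝ᵥ yt) := by
    obtain ⟨a, ha⟩ := exists_smul_dotProduct_self_eq hv ht.le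
    have := hmin xt (a • v) (by rw [ha]; exact hfeas)
    rw [hval, ha] at this
    linarith
  have hs : xt ⬝ᵥ xt < 1 := by linarith
  have hred : ∀ x : Fin n → ℝ, x ⬝ᵥ x ≤ 1 →
      (1 / 2) * (xt ⬝ᵥ (H *ᵥ xt)) - lam1 / 2 * (xt ⬝ᵥ xt) + c ⬝ᵥ xt ≤
        (1 / 2) * (x ⬝ᵥ (H *ᵥ x)) - lam1 / 2 * (x ⬝ᵥ x) + c ⬝ᵥ x := fun x hx => by
    obtain ⟨a, ha⟩ := exists_smul_dotProduct_self_eq hv (sub_nonneg.mpr hx)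
    have := hmin x (a • v) (by rw [ha]; linarith)
    rw [hval, ha, hyH] at this
    nlinarith [mul_nonneg (neg_nonneg.mpr hlam) (sub_nonneg.mpr hfeas)]
  have hstat : ∀ d : Fin n → ℝ, d ⬝ᵥ (H *ᵥ xt) - lam1 * (d ⬝ᵥ xt) + c ⬝ᵥ d = 0 := fun d => by
    refine linear_coeff_eq_zero_of_eventually_nonneg
      (k := (d ⬝ᵥ (H *ᵥ d) - lam1 * (d ⬝ᵥ d)) / 2) ?_
    have hcont : Continuous fun e : ℝ => xt ⬝ᵥ xt + 2 * e * (d ⬝ᵥ xt) + e ^ 2 * (d ⬝ᵥ d) := by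
      fun_prop
    filter_upwards [hcont.continuousAt.eventually_lt (continuousAt_const (y := (1 : ℝ)))
      (by simpa using hs)] with e he
    have := hred (xt + e • d) (by rw [dotProduct_self_add_smul]; exact he.le)
    rw [hH.quadratic_add_smul, dotProduct_self_add_smul, dotProduct_add, dotProduct_smul,
      smul_eq_mul] at this
    linarith
  have hnorm : (xt + θ • yt) ⬝ᵥ (xt + θ • yt) = 1 := by
    have hsq := Real.sq_sqrt (add_nonneg (sq_nonneg (xt ⬝ᵥ yt))
      (mul_nonneg ht.le (sub_nonneg.mpr hs.le)))
    have hθt : θ * (yt ⬝ᵥ yt) =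
        √((xt ⬝ᵥ yt) ^ 2 + (yt ⬝ᵥ yt) * (1 - xt ⬝ᵥ xt)) - xt ⬝ᵥ yt := by
      rw [hθ, div_mul_cancel₀ _ ht.ne']
    rw [eq_add_of_sub_eq hθt.symm] at hsq
    rw [dotProduct_self_add_smul, dotProduct_comm yt xt]
    apply mul_left_cancel₀ ht.ne'
    linarith
  refine ⟨?_, hs, hnorm, fun x hx => ?_⟩
  · refine dotProduct_eq_zero _ fun d => ?_
    rw [dotProduct_comm, dotProduct_add, sub_mulVec, smul_mulVec, one_mulVec, dotProduct_sub,
      dotProduct_smul, smul_eq_mul, dotProduct_comm d c]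
    exact hstat d
  · have hexp := hH.quadratic_add_smul xt yt θ
    have hexp' := dotProduct_self_add_smul xt yt θ
    rw [hnorm] at hexp'
    rw [hyH] at hexp
    rw [hq, hq, hexp, dotProduct_add, dotProduct_smul, smul_eq_mul]
    have h1 := hred x hx
    have h2 := mul_nonneg (neg_nonneg.mpr hlam) (sub_nonneg.mpr hx)
    linear_combination h1 + h2 / 2 + θ * hstat yt - lam1 / 2 * hexp'
end

section
/- Let (x*, y*) ∈ ℝⁿ × ℝⁿ with x*ᵀx* + y*ᵀy* ≤ 1 and let λ ≥ 0 satisfy (H + λI)x* + c = 0, (H + λI)y* = 0 and λ(x*ᵀx* + y*ᵀy* − 1) = 0. Suppose in addition that the second-order condition holds: if x*ᵀx* + y*ᵀy* < 1 then H is positive semidefinite, and if x*ᵀx* + y*ᵀy* = 1 then uᵀ(H + λI)u + vᵀ(H + λI)v ≥ 0 for all u, v ∈ ℝⁿ with uᵀx* + vᵀy* = 0. Then (x*, y*) is a global minimizer of (1/2)xᵀHx + (1/2)yᵀHy + cᵀx over {(x, y) : xᵀx + yᵀy ≤ 1}. -/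
open Matrix

/-- If the form of `M` on pairs is nonnegative on the orthogonal complement of a single pair
`(a, b)`, then `M` itself is positive semidefinite. -/
theorem dotProduct_mulVec_nonneg_of_pair {ι : Type*} [Fintype ι] (M : Matrix ι ι ℝ) (a b : ι → ℝ)
    (h : ∀ u v : ι → ℝ, u ⬝ᵥ a + v ⬝ᵥ b = 0 → 0 ≤ u ⬝ᵥ (M *ᵥ u) + v ⬝ᵥ (M *ᵥ v))
    (w : ι → ℝ) : 0 ≤ w ⬝ᵥ (M *ᵥ w) := by
  by_cases ha : w ⬝ᵥ a = 0
  · simpa using h w 0 (by simp [ha])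
  · have key := h ((w ⬝ᵥ b) • w) (-(w ⬝ᵥ a) • w) (by
      simp only [smul_dotProduct, smul_eq_mul]
      ring)
    simp only [mulVec_smul, smul_dotProduct, dotProduct_smul, smul_eq_mul] at key
    have hpos : 0 < (w ⬝ᵥ a) ^ 2 + (w ⬝ᵥ b) ^ 2 := by positivity
    refine nonneg_of_mul_nonneg_right ?_ hpos
    linarith

/-- Expansion of the quadratic form of a symmetric matrix at a difference. -/
theorem sub_dotProduct_mulVec_sub {ι : Type*} [Fintype ι] {M : Matrix ι ι ℝ} (hM : M.IsSymm)
    (x z : ι → ℝ) :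
    (x - z) ⬝ᵥ (M *ᵥ (x - z)) = x ⬝ᵥ (M *ᵥ x) - 2 * (x ⬝ᵥ (M *ᵥ z)) + z ⬝ᵥ (M *ᵥ z) := by
  have hsymm : z ⬝ᵥ (M *ᵥ x) = x ⬝ᵥ (M *ᵥ z) := by
    rw [dotProduct_mulVec, ← mulVec_transpose, hM.eq, dotProduct_comm]
  simp only [mulVec_sub, sub_dotProduct, dotProduct_sub, hsymm]
  ring

/-- Any second-order stationary point of the lifted problem (D) is a global
minimizer of (D). -/
theorem stmt_4 {n : ℕ} (H : Matrix (Fin n) (Fin n) ℝ) (hH : H.IsSymm)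
    (c : Fin n → ℝ)
    (xs ys : Fin n → ℝ) (hfeas : xs ⬝ᵥ xs + ys ⬝ᵥ ys ≤ 1)
    (lam : ℝ) (hlam : 0 ≤ lam)
    (h1 : (H + lam • (1 : Matrix (Fin n) (Fin n) ℝ)) *ᵥ xs + c = 0)
    (h2 : (H + lam • (1 : Matrix (Fin n) (Fin n) ℝ)) *ᵥ ys = 0)
    (h3 : lam * (xs ⬝ᵥ xs + ys ⬝ᵥ ys - 1) = 0)
    (hso1 : xs ⬝ᵥ xs + ys ⬝ᵥ ys < 1 → ∀ w : Fin n → ℝ, 0 ≤ w ⬝ᵥ (H *ᵥ w))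
    (hso2 : xs ⬝ᵥ xs + ys ⬝ᵥ ys = 1 →
      ∀ u v : Fin n → ℝ, u ⬝ᵥ xs + v ⬝ᵥ ys = 0 →
        0 ≤ u ⬝ᵥ ((H + lam • (1 : Matrix (Fin n) (Fin n) ℝ)) *ᵥ u) +
          v ⬝ᵥ ((H + lam • (1 : Matrix (Fin n) (Fin n) ℝ)) *ᵥ v)) :
    ∀ x y : Fin n → ℝ, x ⬝ᵥ x + y ⬝ᵥ y ≤ 1 →
      (1 / 2) * (xs ⬝ᵥ (H *ᵥ xs)) + (1 / 2) * (ys ⬝ᵥ (H *ᵥ ys)) + c ⬝ᵥ xs ≤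
        (1 / 2) * (x ⬝ᵥ (H *ᵥ x)) + (1 / 2) * (y ⬝ᵥ (H *ᵥ y)) + c ⬝ᵥ x := by
  intro x y hxy
  set M := H + lam • (1 : Matrix (Fin n) (Fin n) ℝ) with hMdef
  have hM : M.IsSymm := hH.add (isSymm_one.smul lam)
  have hq (w : Fin n → ℝ) : w ⬝ᵥ (M *ᵥ w) = w ⬝ᵥ (H *ᵥ w) + lam * (w ⬝ᵥ w) := by
    simp [hMdef, add_mulVec, smul_mulVec]
  have hpsd (w : Fin n → ℝ) : 0 ≤ w ⬝ᵥ (M *ᵥ w) := by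
    rcases hfeas.lt_or_eq with hlt | heq
    · have hlam0 : lam = 0 := (mul_eq_zero.mp h3).resolve_right (by linarith)
      simpa [hq, hlam0] using hso1 hlt w
    · exact dotProduct_mulVec_nonneg_of_pair M xs ys (hso2 heq) w
  have hc (w : Fin n → ℝ) : c ⬝ᵥ w = -(w ⬝ᵥ (M *ᵥ xs)) := by
    rw [eq_neg_of_add_eq_zero_right h1, neg_dotProduct, dotProduct_comm]
  have hx := hpsd (x - xs)
  have hy := hpsd (y - ys)
  rw [sub_dotProduct_mulVec_sub hM] at hx hy
  have hyys : y ⬝ᵥ (M *ᵥ ys) = 0 := by rw [h2, dotProduct_zero]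
  have hysys : ys ⬝ᵥ (M *ᵥ ys) = 0 := by rw [h2, dotProduct_zero]
  have hball := mul_le_mul_of_nonneg_left hxy hlam
  rw [hc, hc]
  linarith [hq x, hq y, hq xs, hq ys]
end

section
/- Let H be an n×n real symmetric matrix, λ ∈ ℝ, and x*, y* ∈ ℝⁿ with x*ᵀx* + y*ᵀy* = 1. If uᵀ(H + λI)u + vᵀ(H + λI)v ≥ 0 for all u, v ∈ ℝⁿ with uᵀx* + vᵀy* = 0, then H + λI is positive semidefinite. -/
open Matrix

/-- Every linear form in two real variables vanishes at a nonzero point. -/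
theorem exists_mul_add_mul_eq_zero_of_real (p q : ℝ) :
    ∃ a b : ℝ, a * p + b * q = 0 ∧ 0 < a * a + b * b := by
  by_cases hp : p = 0
  · exact ⟨1, 0, by simp [hp], by norm_num⟩
  · exact ⟨q, -p, by ring, by nlinarith [mul_self_nonneg q, mul_self_pos.mpr hp]⟩

/-- If `x*ᵀx* + y*ᵀy* = 1` and `uᵀ(H+λI)u + vᵀ(H+λI)v ≥ 0` for all `(u,v)` with
`uᵀx* + vᵀy* = 0`, then `H + λI` is positive semidefinite. -/
theorem stmt_5 {n : ℕ} (H : Matrix (Fin n) (Fin n) ℝ) (hH : H.IsSymm) (lam : ℝ)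
    (xs ys : Fin n → ℝ) (hfeas : xs ⬝ᵥ xs + ys ⬝ᵥ ys = 1)
    (hso : ∀ u v : Fin n → ℝ, u ⬝ᵥ xs + v ⬝ᵥ ys = 0 →
      0 ≤ u ⬝ᵥ ((H + lam • (1 : Matrix (Fin n) (Fin n) ℝ)) *ᵥ u) +
        v ⬝ᵥ ((H + lam • (1 : Matrix (Fin n) (Fin n) ℝ)) *ᵥ v)) :
    ∀ w : Fin n → ℝ, 0 ≤ w ⬝ᵥ ((H + lam • (1 : Matrix (Fin n) (Fin n) ℝ)) *ᵥ w) := by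
  intro w
  obtain ⟨a, b, hab, hpos⟩ := exists_mul_add_mul_eq_zero_of_real (w ⬝ᵥ xs) (w ⬝ᵥ ys)
  have h := hso (a • w) (b • w) (by simpa only [smul_dotProduct, smul_eq_mul] using hab)
  simp only [mulVec_smul, smul_dotProduct, dotProduct_smul, smul_eq_mul, ← mul_assoc,
    ← add_mul] at h
  exact nonneg_of_mul_nonneg_right h hpos
end

section
/- Assume H ≠ 0 and let η ∈ (0, 2/L). The set of initial points z⁰ ∈ B_{2n} for which the (PG2) sequence starting from z⁰ does not converge to a global minimizer of (D') (i.e., to a point z̄ ∈ B_{2n} with f(z̄) ≤ f(z) for all z ∈ B_{2n}) has 2n-dimensional Lebesgue measure zero. -/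
open Matrix MeasureTheory Filter

section

open scoped Topology RealInnerProductSpace

theorem MapClusterPt.eq_of_tendsto_comp {ι X Y : Type*} [TopologicalSpace X]
    [TopologicalSpace Y] [T2Space Y] {l : Filter ι} {u : ι → X} {x : X} {g : X → Y} {y : Y}
    (hx : MapClusterPt x l u) (hg : ContinuousAt g x) (hy : Tendsto (g ∘ u) l (𝓝 y)) :
    g x = y :=
  @eq_of_nhds_neBot _ _ _ _ _ ((hx.continuousAt_comp hg).clusterPt.mono hy)

theorem IsCompact.tendsto_comp_of_mapClusterPt {ι X Y : Type*} [TopologicalSpace X]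
    [TopologicalSpace Y] {l : Filter ι} {u : ι → X} {K : Set X} {g : X → Y} {y : Y}
    (hK : IsCompact K) (hu : ∀ᶠ i in l, u i ∈ K) (hg : Continuous g)
    (h : ∀ x, MapClusterPt x l u → g x = y) : Tendsto (g ∘ u) l (𝓝 y) := by
  rw [tendsto_iff_ultrafilter]
  intro U hU
  obtain ⟨x, -, hx⟩ := hK.ultrafilter_le_nhds (U.map u) (by
    rw [le_principal_iff]; exact hU hu)
  have hx' : Tendsto u U (𝓝 x) := hx
  rw [← h x (mapClusterPt_iff_ultrafilter.2 ⟨U, hU, hx'⟩)]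
  exact (hg.tendsto x).comp hx'

variable {E : Type*} [NormedAddCommGroup E] [InnerProductSpace ℝ E]

/-- The metric projection onto the closed unit ball of a real inner product space. -/
noncomputable def ballProj (w : E) : E := (max ‖w‖ 1)⁻¹ • w

theorem max_smul_ballProj (w : E) : max ‖w‖ 1 • ballProj w = w := by
  have : max ‖w‖ 1 ≠ 0 := by positivity
  simp [ballProj, smul_smul, this]

theorem max_mul_norm_ballProj (w : E) : max ‖w‖ 1 * ‖ballProj w‖ = ‖w‖ := by
  conv_rhs => rw [← max_smul_ballProj w]
  rw [norm_smul, Real.norm_of_nonneg (by positivity)]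

theorem norm_ballProj_le (w : E) : ‖ballProj w‖ ≤ 1 := by
  have h := max_mul_norm_ballProj w
  have h0 : 0 < max ‖w‖ 1 := by positivity
  by_contra! h1
  nlinarith [le_max_left ‖w‖ 1]

theorem ballProj_complementarity (w : E) : (max ‖w‖ 1 - 1) * (1 - ‖ballProj w‖ ^ 2) = 0 := by
  have h := max_mul_norm_ballProj w
  rcases le_total ‖w‖ 1 with h1 | h1
  · simp [max_eq_right h1]
  · rw [max_eq_left h1] at h
    have : ‖ballProj w‖ = 1 := by
      have : ‖w‖ ≠ 0 := by positivity
      exact (mul_eq_left₀ this).1 h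
    simp [this]

theorem inner_sub_ballProj_nonpos (w : E) {p : E} (hp : ‖p‖ ≤ 1) :
    ⟪w - ballProj w, p - ballProj w⟫ ≤ 0 := by
  have h := ballProj_complementarity w
  have h1 := norm_ballProj_le w
  have h2 := real_inner_le_norm (ballProj w) p
  have h3 : 0 ≤ max ‖w‖ 1 - 1 := sub_nonneg.2 (le_max_right _ _)
  have h4 : ⟪w - ballProj w, p - ballProj w⟫
      = (max ‖w‖ 1 - 1) * (⟪ballProj w, p⟫ - ‖ballProj w‖ ^ 2) := by
    have h6 : w - ballProj w = (max ‖w‖ 1 - 1) • ballProj w := by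
      rw [sub_smul, max_smul_ballProj, one_smul]
    rw [h6, ← real_inner_self_eq_norm_sq]
    simp only [inner_sub_right, real_inner_smul_left]
    ring
  have h5 : ⟪ballProj w, p⟫ ≤ 1 := h2.trans (mul_le_one₀ h1 (norm_nonneg _) hp)
  rw [h4]
  nlinarith

theorem norm_ballProj_sub_le (w : E) {p : E} (hp : ‖p‖ ≤ 1) : ‖ballProj w - p‖ ≤ ‖w - p‖ := by
  have h := inner_sub_ballProj_nonpos w hp
  have h1 : ‖w - p‖ ^ 2 = ‖w - ballProj w‖ ^ 2 - 2 * ⟪w - ballProj w, p - ballProj w⟫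
      + ‖ballProj w - p‖ ^ 2 := by
    rw [norm_sub_rev (ballProj w), ← norm_sub_sq_real, sub_sub_sub_cancel_right]
  nlinarith [norm_nonneg (w - p), norm_nonneg (ballProj w - p), sq_nonneg ‖w - ballProj w‖]

theorem continuous_ballProj : Continuous (ballProj : E → E) := by
  unfold ballProj
  exact ((continuous_norm.max continuous_const).inv₀ fun w => by positivity).smul continuous_id

/-- The quadratic objective `z ↦ ½⟪T z, z⟫ + ⟪a, z⟫`. -/
noncomputable def quadObj (T : E →ₗ[ℝ] E) (a z : E) : ℝ := 1 / 2 * ⟪T z, z⟫ + ⟪a, z⟫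

/-- The norm by which a projected gradient step for `quadObj T a` on the unit ball rescales. -/
noncomputable def projGradScale (T : E →ₗ[ℝ] E) (a : E) (η : ℝ) (z : E) : ℝ :=
  max ‖z - η • (T z + a)‖ 1

/-- One projected gradient step of size `η` for `quadObj T a` on the unit ball. -/
noncomputable def projGradStep (T : E →ₗ[ℝ] E) (a : E) (η : ℝ) (z : E) : E :=
  ballProj (z - η • (T z + a))

variable {T : E →ₗ[ℝ] E} {a : E} {η : ℝ}

theorem one_le_projGradScale (z : E) : 1 ≤ projGradScale T a η z := le_max_right _ _

theorem projGradScale_smul_step (z : E) :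
    projGradScale T a η z • projGradStep T a η z = z - η • (T z + a) :=
  max_smul_ballProj _

theorem norm_projGradStep_le (z : E) : ‖projGradStep T a η z‖ ≤ 1 := norm_ballProj_le _

theorem norm_iterate_projGradStep_le {z : E} (hz : ‖z‖ ≤ 1) (k : ℕ) :
    ‖(projGradStep T a η)^[k] z‖ ≤ 1 := by
  cases k with
  | zero => exact hz
  | succ k => rw [Function.iterate_succ_apply']; exact norm_projGradStep_le _

theorem smul_map_of_isFixedPt {z : E} (hz : projGradStep T a η z = z) :
    η • T z = -((projGradScale T a η z - 1) • z) - η • a := by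
  have h := projGradScale_smul_step (T := T) (a := a) (η := η) z
  rw [hz, smul_add] at h
  rw [sub_smul, one_smul, h]
  abel

theorem complementarity_of_isFixedPt {z : E} (hz : projGradStep T a η z = z) :
    (projGradScale T a η z - 1) * (1 - ‖z‖ ^ 2) = 0 := by
  have h := ballProj_complementarity (z - η • (T z + a))
  rwa [← projGradStep, hz] at h

theorem mul_inner_map_of_isFixedPt {z : E} (hz : projGradStep T a η z = z) (w : E) :
    η * ⟪T z, w⟫ = -((projGradScale T a η z - 1) * ⟪z, w⟫) - η * ⟪a, w⟫ := by
  have h := congrArg (fun x => ⟪x, w⟫) (smul_map_of_isFixedPt hz)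
  simpa [inner_sub_left, inner_neg_left, real_inner_smul_left] using h

/-- Two fixed points of the projected gradient step at the same objective level have the same
multiplier. -/
theorem projGradScale_eq_of_quadObj_eq (hT : T.IsSymmetric) {z z' : E}
    (hz : projGradStep T a η z = z) (hz' : projGradStep T a η z' = z')
    (hf : quadObj T a z = quadObj T a z') :
    projGradScale T a η z = projGradScale T a η z' := by
  have hn : ‖z‖ ≤ 1 := hz ▸ norm_projGradStep_le z
  have hn' : ‖z'‖ ≤ 1 := hz' ▸ norm_projGradStep_le z'
  have e1 := mul_inner_map_of_isFixedPt hz z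
  have e2 := mul_inner_map_of_isFixedPt hz z'
  have e3 := mul_inner_map_of_isFixedPt hz' z
  have e4 := mul_inner_map_of_isFixedPt hz' z'
  have c1 := complementarity_of_isFixedPt hz
  have c2 := complementarity_of_isFixedPt hz'
  have hs : ⟪T z', z⟫ = ⟪T z, z'⟫ := by rw [hT z' z, real_inner_comm]
  rw [hs, real_inner_comm z z'] at e3
  rw [real_inner_self_eq_norm_sq] at e1 e4
  unfold quadObj at hf
  have key : (projGradScale T a η z - projGradScale T a η z') * (1 - ⟪z, z'⟫) = 0 := by
    linear_combination (-2 * η) * hf + e1 - e4 - e2 + e3 + c1 - c2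
  rcases mul_eq_zero.1 key with h | h
  · exact sub_eq_zero.1 h
  · have hzz : ‖z - z'‖ ^ 2 ≤ 0 := by
      rw [norm_sub_sq_real]
      nlinarith [norm_nonneg z, norm_nonneg z']
    have : z = z' := by
      rw [← sub_eq_zero, ← norm_eq_zero]
      exact pow_eq_zero_iff two_ne_zero |>.1 (le_antisymm hzz (sq_nonneg _))
    rw [this]

/-- A fixed point whose multiplier dominates the bottom of the spectrum is a global minimizer. -/
theorem quadObj_le_of_isFixedPt (hT : T.IsSymmetric) (hη : 0 < η) {lam : ℝ}
    (hlam : ∀ x, lam * ‖x‖ ^ 2 ≤ ⟪T x, x⟫) {z : E} (hz : projGradStep T a η z = z)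
    (hs : 1 - η * lam ≤ projGradScale T a η z) {w : E} (hw : ‖w‖ ≤ 1) :
    quadObj T a z ≤ quadObj T a w := by
  have e1 := mul_inner_map_of_isFixedPt hz z
  have e2 := mul_inner_map_of_isFixedPt hz w
  have c1 := complementarity_of_isFixedPt hz
  have h1 := one_le_projGradScale (T := T) (a := a) (η := η) z
  have h2 := hlam (w - z)
  have hs' : ⟪T w, z⟫ = ⟪T z, w⟫ := by rw [hT w z, real_inner_comm]
  rw [norm_sub_sq_real, real_inner_comm z w] at h2
  simp only [map_sub, inner_sub_left, inner_sub_right, hs'] at h2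
  rw [real_inner_self_eq_norm_sq] at e1
  have hd : 0 ≤ ‖w‖ ^ 2 - 2 * ⟪z, w⟫ + ‖z‖ ^ 2 := by
    rw [real_inner_comm, ← norm_sub_sq_real]; positivity
  have h3 := mul_le_mul_of_nonneg_left h2 hη.le
  have h4 := mul_nonneg (sub_nonneg.2 hs) hd
  have h5 : 0 ≤ (projGradScale T a η z - 1) * (1 - ‖w‖ ^ 2) := by
    apply mul_nonneg (by linarith)
    nlinarith [norm_nonneg w]
  unfold quadObj
  refine le_of_mul_le_mul_left ?_ hη
  nlinarith

/-- Sufficient decrease of a projected gradient step. -/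
theorem quadObj_projGradStep_le (hT : T.IsSymmetric) (hη : 0 < η) {L : ℝ}
    (hL : ∀ x, ⟪T x, x⟫ ≤ L * ‖x‖ ^ 2) {z : E} (hz : ‖z‖ ≤ 1) :
    quadObj T a (projGradStep T a η z) + (1 / η - L / 2) * ‖projGradStep T a η z - z‖ ^ 2
      ≤ quadObj T a z := by
  have h1 := inner_sub_ballProj_nonpos (z - η • (T z + a)) hz
  rw [← projGradStep] at h1
  set e := projGradStep T a η z - z with he
  have hy : projGradStep T a η z = z + e := by rw [he]; abel
  have h2 := hL e
  have h3 : ‖e‖ ^ 2 + η * (⟪T z, e⟫ + ⟪a, e⟫) ≤ 0 := by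
    have : z - η • (T z + a) - projGradStep T a η z = -(e + η • (T z + a)) := by rw [hy]; abel
    rw [this, show z - projGradStep T a η z = -e by rw [hy]; abel, inner_neg_neg, inner_add_left,
      real_inner_smul_left, inner_add_left, real_inner_self_eq_norm_sq] at h1
    exact h1
  have h4 : 1 / η * ‖e‖ ^ 2 ≤ -(⟪T z, e⟫ + ⟪a, e⟫) := by
    rw [div_mul_eq_mul_div, div_le_iff₀ hη]; linarith
  have hs : ⟪T e, z⟫ = ⟪T z, e⟫ := by rw [hT e z, real_inner_comm]
  rw [hy]
  simp only [quadObj, map_add, inner_add_left, inner_add_right, hs]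
  linarith

/-- A symmetric operator between `0` and `L` makes the gradient step with `η L ≤ 2`
nonexpansive. -/
theorem norm_sub_smul_map_le (hT : T.IsSymmetric) {L : ℝ} (hL0 : 0 < L) (hη : 0 ≤ η)
    (hηL : η * L ≤ 2) (hL : ∀ x, ⟪T x, x⟫ ≤ L * ‖x‖ ^ 2) (hpos : ∀ x, 0 ≤ ⟪T x, x⟫) (x : E) :
    ‖x - η • T x‖ ≤ ‖x‖ := by
  have h1 := hpos (L • x - T x)
  have h2 := hL (T x)
  have hs : ⟪T (T x), x⟫ = ‖T x‖ ^ 2 := by rw [hT (T x) x, real_inner_self_eq_norm_sq]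
  simp only [map_sub, map_smul, inner_sub_left, inner_sub_right, real_inner_smul_left,
    real_inner_smul_right, hs, real_inner_self_eq_norm_sq] at h1
  have h3 : ‖T x‖ ^ 2 ≤ L * ⟪T x, x⟫ := by
    refine le_of_mul_le_mul_left ?_ hL0
    linarith
  have h4 : ‖x - η • T x‖ ^ 2 = ‖x‖ ^ 2 - 2 * η * ⟪T x, x⟫ + η ^ 2 * ‖T x‖ ^ 2 := by
    rw [norm_sub_sq_real, real_inner_smul_right, real_inner_comm, norm_smul, mul_pow,
      Real.norm_eq_abs, sq_abs]
    ring
  have h5 := mul_le_mul_of_nonneg_left h3 (sq_nonneg η)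
  have h6 := mul_nonneg (mul_nonneg hη (hpos x)) (sub_nonneg.2 hηL)
  refine le_of_sq_le_sq ?_ (norm_nonneg _)
  nlinarith

/-- Eigenvectors orthogonal to the linear term evolve by scaling under the projected gradient
step. -/
theorem projGradScale_mul_inner_step (hT : T.IsSymmetric) {v : E} {lam : ℝ}
    (hv : T v = lam • v) (hva : ⟪v, a⟫ = 0) (z : E) :
    projGradScale T a η z * ⟪v, projGradStep T a η z⟫ = (1 - η * lam) * ⟪v, z⟫ := by
  rw [← real_inner_smul_right, projGradScale_smul_step, inner_sub_right, real_inner_smul_right,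
    inner_add_right, ← hT v z, hv, hva, real_inner_smul_left]
  ring

/-- The limiting multiplier dominates `1 - η λ` as soon as the starting point has a component
along an eigenvector for `λ` that is orthogonal to the linear term. -/
theorem le_projGradScale_of_mapClusterPt (hT : T.IsSymmetric) {v : E} {lam : ℝ}
    (hv : T v = lam • v) (hva : ⟪v, a⟫ = 0) {z₀ z : E} (hv0 : ⟪v, z₀⟫ ≠ 0)
    (hz : MapClusterPt z atTop (fun k => (projGradStep T a η)^[k] z₀))
    (hfix : projGradStep T a η z = z)
    (hs : Tendsto (fun k => projGradScale T a η ((projGradStep T a η)^[k] z₀)) atTop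
      (𝓝 (projGradScale T a η z))) :
    1 - η * lam ≤ projGradScale T a η z := by
  by_contra! hlt
  set u : ℕ → E := fun k => (projGradStep T a η)^[k] z₀ with hu
  have hstep : ∀ k, projGradScale T a η (u k) * ⟪v, u (k + 1)⟫ = (1 - η * lam) * ⟪v, u k⟫ :=
    fun k => by
      rw [hu]; simp only [Function.iterate_succ_apply']
      exact projGradScale_mul_inner_step hT hv hva _
  have h1 := one_le_projGradScale (T := T) (a := a) (η := η) z
  have hne : ∀ k, ⟪v, u k⟫ ≠ 0 := by
    intro k
    induction k with
    | zero => exact hv0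
    | succ k ih =>
      intro h0
      have := hstep k
      rw [h0, mul_zero] at this
      exact mul_ne_zero (by linarith) ih this.symm
  obtain ⟨K, hK⟩ := eventually_atTop.1 (hs.eventually_lt_const hlt)
  have hmono : ∀ k ≥ K, |⟪v, u K⟫| ≤ |⟪v, u k⟫| := by
    intro k hk
    induction k, hk using Nat.le_induction with
    | base => exact le_rfl
    | succ k hk ih =>
      refine ih.trans ?_
      have h2 := congrArg abs (hstep k)
      have h3 := one_le_projGradScale (T := T) (a := a) (η := η) (u k)
      have h4 : projGradScale T a η (u k) < 1 - η * lam := hK k hk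
      rw [abs_mul, abs_mul, abs_of_pos (one_pos.trans_le h3),
        abs_of_pos (one_pos.trans_le (h3.trans h4.le))] at h2
      have h5 := mul_le_mul_of_nonneg_right h4.le (abs_nonneg ⟪v, u (k + 1)⟫)
      rw [h2] at h5
      exact le_of_mul_le_mul_left h5 (by linarith)
  have hclosed : IsClosed {x : E | |⟪v, u K⟫| ≤ |⟪v, x⟫|} :=
    isClosed_le continuous_const (by fun_prop)
  have hge : |⟪v, u K⟫| ≤ |⟪v, z⟫| :=
    hclosed.mem_of_mapClusterPt hz (eventually_atTop.2 ⟨K, hmono⟩)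
  have hz0 := projGradScale_mul_inner_step (η := η) hT hv hva z
  rw [hfix] at hz0
  have : ⟪v, z⟫ = 0 := by
    have : (projGradScale T a η z - (1 - η * lam)) * ⟪v, z⟫ = 0 := by linear_combination hz0
    exact (mul_eq_zero.1 this).resolve_left (by linarith)
  rw [this, abs_zero] at hge
  exact hne K (abs_nonpos_iff.1 hge)

/-- Cluster points of the projected gradient sequence sharing a nontrivial multiplier that dominates
the bottom of the spectrum coincide. -/
theorem eq_of_mapClusterPt_of_one_lt (hT : T.IsSymmetric) (hη : 0 < η) {v : E} {lam : ℝ}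
    (hv : T v = lam • v) (hva : ⟪v, a⟫ = 0) (hlam : ∀ x, lam * ‖x‖ ^ 2 ≤ ⟪T x, x⟫)
    {z₀ z z' : E} (hv0 : ⟪v, z₀⟫ ≠ 0)
    (hz : MapClusterPt z atTop (fun k => (projGradStep T a η)^[k] z₀))
    (hz' : MapClusterPt z' atTop (fun k => (projGradStep T a η)^[k] z₀))
    (hfix : projGradStep T a η z = z) (hfix' : projGradStep T a η z' = z')
    (heq : projGradScale T a η z' = projGradScale T a η z)
    (hge : 1 - η * lam ≤ projGradScale T a η z) (hone : 1 < projGradScale T a η z) :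
    z' = z := by
  by_contra hne
  set s := projGradScale T a η z with hs
  set d := z' - z with hd
  have hd0 : 0 < ‖d‖ ^ 2 := by
    have := sub_ne_zero.2 hne
    positivity
  have hn : ‖z‖ ^ 2 = 1 := by
    have := (mul_eq_zero.1 (complementarity_of_isFixedPt hfix)).resolve_left (by linarith)
    linarith
  have hn' : ‖z'‖ ^ 2 = 1 := by
    have := (mul_eq_zero.1 (complementarity_of_isFixedPt hfix')).resolve_left (by linarith)
    linarith
  have hTd : η • T d = -((s - 1) • d) := by
    have h1 := smul_map_of_isFixedPt hfix
    have h2 := smul_map_of_isFixedPt hfix'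
    rw [heq] at h2
    rw [hd, map_sub, smul_sub, h1, h2, smul_sub]
    abel
  have hTdi : ∀ x, η * ⟪T d, x⟫ = -((s - 1) * ⟪d, x⟫) := fun x => by
    rw [← real_inner_smul_left, hTd, inner_neg_left, real_inner_smul_left]
  have hmu : 1 - η * lam = s := by
    refine le_antisymm hge ?_
    have h1 := mul_le_mul_of_nonneg_left (hlam d) hη.le
    rw [hTdi, real_inner_self_eq_norm_sq] at h1
    by_contra! h2
    nlinarith
  have hda : ⟪d, a⟫ = 0 := by
    have h1 := mul_inner_map_of_isFixedPt hfix d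
    have h2 := hTdi z
    rw [hT d z, real_inner_comm] at h2
    rw [real_inner_comm d z, real_inner_comm d a] at h1
    rw [← hs] at h1
    have : η * ⟪d, a⟫ = 0 := by linarith
    exact (mul_eq_zero.1 this).resolve_left hη.ne'
  have hdl : T d = lam • d := by
    apply smul_right_injective E hη.ne'
    simp only
    rw [hTd, smul_smul, ← neg_smul]
    congr 1
    linarith
  set u : ℕ → E := fun k => (projGradStep T a η)^[k] z₀ with hu
  have hus : ∀ k, u (k + 1) = projGradStep T a η (u k) := fun k =>
    Function.iterate_succ_apply' _ _ _
  have hscale : ∀ k, 0 < projGradScale T a η (u k) := fun k =>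
    one_pos.trans_le (one_le_projGradScale _)
  have hprop : ∀ k, ⟪d, u k⟫ * ⟪v, z₀⟫ = ⟪v, u k⟫ * ⟪d, z₀⟫ := by
    intro k
    induction k with
    | zero => exact mul_comm _ _
    | succ k ih =>
      have h1 := projGradScale_mul_inner_step (η := η) hT hv hva (u k)
      have h2 := projGradScale_mul_inner_step (η := η) hT hdl hda (u k)
      rw [hus]
      refine mul_left_cancel₀ (hscale k).ne' ?_
      linear_combination ⟪v, z₀⟫ * h2 - ⟪d, z₀⟫ * h1 + (1 - η * lam) * ih
  have hsign : ∀ k, 0 ≤ ⟪v, z₀⟫ * ⟪v, u k⟫ := by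
    intro k
    induction k with
    | zero => exact mul_self_nonneg _
    | succ k ih =>
      have h1 := projGradScale_mul_inner_step (η := η) hT hv hva (u k)
      rw [hus]
      refine nonneg_of_mul_nonneg_right (a := projGradScale T a η (u k)) ?_ (hscale k)
      rw [mul_left_comm, h1, mul_left_comm]
      exact mul_nonneg (by linarith) ih
  have hcl : ∀ x, MapClusterPt x atTop u →
      ⟪d, x⟫ * ⟪v, z₀⟫ = ⟪v, x⟫ * ⟪d, z₀⟫ ∧ 0 ≤ ⟪v, z₀⟫ * ⟪v, x⟫ := by
    intro x hx
    have h1 : IsClosed {x : E | ⟪d, x⟫ * ⟪v, z₀⟫ = ⟪v, x⟫ * ⟪d, z₀⟫} :=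
      isClosed_eq (by fun_prop) (by fun_prop)
    have h2 : IsClosed {x : E | 0 ≤ ⟪v, z₀⟫ * ⟪v, x⟫} :=
      isClosed_le continuous_const (by fun_prop)
    exact ⟨h1.mem_of_mapClusterPt hx (Eventually.of_forall hprop),
      h2.mem_of_mapClusterPt hx (Eventually.of_forall hsign)⟩
  obtain ⟨p1, q1⟩ := hcl z hz
  obtain ⟨p2, q2⟩ := hcl z' hz'
  have hsum : ⟪d, z'⟫ + ⟪d, z⟫ = 0 := by
    rw [hd, inner_sub_left, inner_sub_left, real_inner_self_eq_norm_sq,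
      real_inner_self_eq_norm_sq, real_inner_comm z' z]
    linarith
  have hdiff : ⟪d, z'⟫ - ⟪d, z⟫ = ‖d‖ ^ 2 := by
    rw [← inner_sub_right, real_inner_self_eq_norm_sq]
  have hprod : ⟪d, z₀⟫ * (⟪v, z₀⟫ * ⟪v, z⟫ + ⟪v, z₀⟫ * ⟪v, z'⟫) = 0 := by
    linear_combination ⟪v, z₀⟫ ^ 2 * hsum - ⟪v, z₀⟫ * p1 - ⟪v, z₀⟫ * p2
  have hzero : ⟪v, z⟫ * ⟪d, z₀⟫ = 0 := by
    rcases mul_eq_zero.1 hprod with h | h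
    · rw [h, mul_zero]
    · have : ⟪v, z₀⟫ * ⟪v, z⟫ = 0 := by linarith
      rw [(mul_eq_zero.1 this).resolve_left hv0, zero_mul]
  have : ⟪d, z⟫ = 0 := (mul_eq_zero.1 (p1.trans hzero)).resolve_right hv0
  linarith

section FiniteDimensional
variable [FiniteDimensional ℝ E]

theorem continuous_projGradScale : Continuous (projGradScale T a η) := by
  have := T.continuous_of_finiteDimensional
  unfold projGradScale
  fun_prop

theorem continuous_projGradStep : Continuous (projGradStep T a η) := by
  have := T.continuous_of_finiteDimensional
  exact continuous_ballProj.comp (by fun_prop)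

theorem continuous_quadObj : Continuous (quadObj T a) := by
  have := T.continuous_of_finiteDimensional
  unfold quadObj
  fun_prop

theorem exists_tendsto_quadObj_iterate (hT : T.IsSymmetric) (hη : 0 < η) {L : ℝ}
    (hηL : η * L < 2) (hL : ∀ x, ⟪T x, x⟫ ≤ L * ‖x‖ ^ 2) {z₀ : E} (hz₀ : ‖z₀‖ ≤ 1) :
    ∃ m, Tendsto (fun k => quadObj T a ((projGradStep T a η)^[k] z₀)) atTop (𝓝 m) ∧
      ∀ z, MapClusterPt z atTop (fun k => (projGradStep T a η)^[k] z₀) →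
        projGradStep T a η z = z := by
  set u : ℕ → E := fun k => (projGradStep T a η)^[k] z₀ with hu
  have hu1 : ∀ k, ‖u k‖ ≤ 1 := norm_iterate_projGradStep_le hz₀
  have hus : ∀ k, u (k + 1) = projGradStep T a η (u k) := fun k =>
    Function.iterate_succ_apply' _ _ _
  have hc : 0 < 1 / η - L / 2 := by
    rw [sub_pos, div_lt_div_iff₀ two_pos hη]; linarith
  have hdesc : ∀ k, quadObj T a (u (k + 1)) + (1 / η - L / 2) * ‖u (k + 1) - u k‖ ^ 2
      ≤ quadObj T a (u k) := fun k => by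
    rw [hus]; exact quadObj_projGradStep_le hT hη hL (hu1 k)
  have hanti : Antitone fun k => quadObj T a (u k) := antitone_nat_of_succ_le fun k => by
    have := hdesc k
    have : 0 ≤ (1 / η - L / 2) * ‖u (k + 1) - u k‖ ^ 2 := by positivity
    linarith
  have hbdd : BddBelow (Set.range fun k => quadObj T a (u k)) := by
    have := (isCompact_closedBall (0 : E) 1).bddBelow_image
      (continuous_quadObj (T := T) (a := a)).continuousOn
    refine this.mono ?_
    rintro _ ⟨k, rfl⟩
    exact ⟨u k, by simpa using hu1 k, rfl⟩
  have hlim := tendsto_atTop_ciInf hanti hbdd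
  refine ⟨_, hlim, fun z hz => ?_⟩
  have hdiff : Tendsto (fun k => ‖u (k + 1) - u k‖ ^ 2) atTop (𝓝 0) := by
    have h1 : Tendsto (fun k => (quadObj T a (u k) - quadObj T a (u (k + 1))) / (1 / η - L / 2))
        atTop (𝓝 0) := by
      simpa using (hlim.sub (hlim.comp (tendsto_add_atTop_nat 1))).div_const (1 / η - L / 2)
    refine squeeze_zero (fun k => by positivity) (fun k => ?_) h1
    rw [le_div_iff₀ hc]
    linarith [hdesc k]
  have hcont : Continuous fun z => ‖projGradStep T a η z - z‖ ^ 2 := by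
    have := continuous_projGradStep (T := T) (a := a) (η := η)
    fun_prop
  have h0 : ‖projGradStep T a η z - z‖ ^ 2 = 0 :=
    hz.eq_of_tendsto_comp (g := fun z => ‖projGradStep T a η z - z‖ ^ 2) hcont.continuousAt (by
      simpa only [Function.comp_def, ← hus] using hdiff)
  simpa [sub_eq_zero] using h0

/-- Convergence of the projected gradient iteration to a global minimizer, provided the bottom of
the spectrum has an eigenvector orthogonal to the linear term but not to the starting point. -/
theorem exists_tendsto_projGradStep_iterate (hT : T.IsSymmetric) (hη : 0 < η) {L : ℝ}
    (hL0 : 0 < L) (hηL : η * L < 2) (hL : ∀ x, ⟪T x, x⟫ ≤ L * ‖x‖ ^ 2) {v : E} {lam : ℝ}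
    (hv : T v = lam • v) (hva : ⟪v, a⟫ = 0) (hlam : ∀ x, lam * ‖x‖ ^ 2 ≤ ⟪T x, x⟫)
    {z₀ : E} (hz₀ : ‖z₀‖ ≤ 1) (hv0 : ⟪v, z₀⟫ ≠ 0) :
    ∃ z, (‖z‖ ≤ 1 ∧ ∀ w, ‖w‖ ≤ 1 → quadObj T a z ≤ quadObj T a w) ∧
      Tendsto (fun k => (projGradStep T a η)^[k] z₀) atTop (𝓝 z) := by
  obtain ⟨m, hm, hfix⟩ := exists_tendsto_quadObj_iterate (a := a) hT hη hηL hL hz₀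
  set u : ℕ → E := fun k => (projGradStep T a η)^[k] z₀ with hu
  have hK : IsCompact (Metric.closedBall (0 : E) 1) := isCompact_closedBall _ _
  have huK : ∀ k, u k ∈ Metric.closedBall (0 : E) 1 := fun k => by
    simpa using norm_iterate_projGradStep_le hz₀ k
  obtain ⟨z, hz1, hz⟩ := hK.exists_mapClusterPt (f := atTop) (u := u)
    (tendsto_principal.2 (Eventually.of_forall huK))
  have hzn : ‖z‖ ≤ 1 := by simpa using hz1
  have hval : ∀ x, MapClusterPt x atTop u → quadObj T a x = m := fun x hx =>
    hx.eq_of_tendsto_comp continuous_quadObj.continuousAt hm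
  have hscale : ∀ x, MapClusterPt x atTop u →
      projGradScale T a η x = projGradScale T a η z := fun x hx =>
    projGradScale_eq_of_quadObj_eq hT (hfix x hx) (hfix z hz) (by rw [hval x hx, hval z hz])
  have hs := hK.tendsto_comp_of_mapClusterPt (Eventually.of_forall huK)
    continuous_projGradScale hscale
  have hge := le_projGradScale_of_mapClusterPt hT hv hva hv0 hz (hfix z hz) hs
  refine ⟨z, ⟨hzn, fun w hw => quadObj_le_of_isFixedPt hT hη hlam (hfix z hz) hge hw⟩, ?_⟩
  rcases (one_le_projGradScale (T := T) (a := a) (η := η) z).eq_or_lt with h1 | h1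
  · have hlam0 : 0 ≤ lam := by
      by_contra! h
      nlinarith
    have hzw : z - η • (T z + a) = z := by
      rw [← projGradScale_smul_step, ← h1, one_smul, hfix z hz]
    have hstep : ∀ x, ‖projGradStep T a η x - z‖ ≤ ‖x - z‖ := fun x => by
      refine (norm_ballProj_sub_le _ hzn).trans ?_
      have h2 : x - η • (T x + a) - z = (x - z) - η • T (x - z) := by
        conv_lhs => rw [← hzw]
        rw [map_sub, smul_sub, smul_add, smul_add]
        abel
      rw [h2]
      exact norm_sub_smul_map_le hT hL0 hη.le hηL.le hL
        (fun y => (by positivity : 0 ≤ lam * ‖y‖ ^ 2).trans (hlam y)) _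
    have hanti : Antitone fun k => ‖u k - z‖ := antitone_nat_of_succ_le fun k => by
      rw [hu]; simp only [Function.iterate_succ_apply']
      exact hstep _
    have hlim := tendsto_atTop_ciInf hanti ⟨0, by rintro _ ⟨k, rfl⟩; exact norm_nonneg _⟩
    have h0 := hz.eq_of_tendsto_comp (g := fun x => ‖x - z‖)
      (by fun_prop : Continuous fun x : E => ‖x - z‖).continuousAt hlim
    rw [← h0] at hlim
    rw [tendsto_iff_norm_sub_tendsto_zero]
    simpa using hlim
  · exact hK.tendsto_nhds_of_unique_mapClusterPt (Eventually.of_forall huK) fun x _ hx =>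
      eq_of_mapClusterPt_of_one_lt hT hη hv hva hlam hv0 hz hx (hfix z hz) (hfix x hx)
        (hscale x hx) hge h1

end FiniteDimensional

/-- The bottom of the spectrum of a symmetric operator is an eigenvalue. -/
theorem LinearMap.IsSymmetric.exists_eigenvector_forall_le [FiniteDimensional ℝ E] [Nontrivial E]
    (hT : T.IsSymmetric) :
    ∃ (lam : ℝ) (v : E), v ≠ 0 ∧ T v = lam • v ∧ ∀ x, lam * ‖x‖ ^ 2 ≤ ⟪T x, x⟫ := by
  obtain ⟨v, hv⟩ := hT.hasEigenvalue_iInf_of_finiteDimensional.exists_hasEigenvector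
  refine ⟨_, v, hv.2, hv.apply_eq_smul, fun x => ?_⟩
  by_cases hx : x = 0
  · simp [hx]
  rw [← le_div_iff₀ (by positivity)]
  refine ciInf_le (f := fun x : {x : E // x ≠ 0} => RCLike.re ⟪T x, x⟫ / ‖(x : E)‖ ^ 2)
    ⟨-‖T.toContinuousLinearMap‖, ?_⟩ ⟨x, hx⟩
  rintro _ ⟨⟨y, hy⟩, rfl⟩
  rw [le_div_iff₀ (by positivity)]
  have h1 := abs_real_inner_le_norm (T y) y
  have h2 := T.toContinuousLinearMap.le_opNorm y
  simp only [LinearMap.coe_toContinuousLinearMap'] at h2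
  have h3 := mul_le_mul_of_nonneg_right h2 (norm_nonneg y)
  have h4 := neg_le_of_abs_le h1
  simp only [RCLike.re_to_real]
  linarith

end

theorem EuclideanSpace.real_inner_eq_dotProduct {ι : Type*} [Fintype ι]
    (x y : EuclideanSpace ℝ ι) : inner ℝ x y = x.ofLp ⬝ᵥ y.ofLp := by
  rw [EuclideanSpace.inner_eq_star_dotProduct, star_trivial, dotProduct_comm]

theorem EuclideanSpace.real_norm_sq_eq_dotProduct {ι : Type*} [Fintype ι]
    (x : EuclideanSpace ℝ ι) : ‖x‖ ^ 2 = x.ofLp ⬝ᵥ x.ofLp := by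
  rw [← real_inner_self_eq_norm_sq, EuclideanSpace.real_inner_eq_dotProduct]

theorem volume_setOf_dotProduct_eq_zero {ι : Type*} [Fintype ι] {w : ι → ℝ} (hw : w ≠ 0) :
    volume {z : ι → ℝ | w ⬝ᵥ z = 0} = 0 := by
  let g : (ι → ℝ) →ₗ[ℝ] ℝ :=
    { toFun := fun z => w ⬝ᵥ z
      map_add' := dotProduct_add w
      map_smul' := fun r z => dotProduct_smul r w z }
  refine Measure.addHaar_submodule volume (LinearMap.ker g) fun h => hw ?_
  have : w ∈ LinearMap.ker g := h ▸ Submodule.mem_top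
  exact dotProduct_self_eq_zero.1 (LinearMap.mem_ker.1 this)

theorem fromBlocks_diag_mulVec_dotProduct {ι : Type*} [Fintype ι] (H : Matrix ι ι ℝ)
    (z : ι ⊕ ι → ℝ) :
    (fromBlocks H 0 0 H *ᵥ z) ⬝ᵥ z = (H *ᵥ (z ∘ Sum.inl)) ⬝ᵥ (z ∘ Sum.inl)
      + (H *ᵥ (z ∘ Sum.inr)) ⬝ᵥ (z ∘ Sum.inr) := by
  simp [fromBlocks_mulVec, dotProduct]

theorem dotProduct_self_sum {ι κ : Type*} [Fintype ι] [Fintype κ] (z : ι ⊕ κ → ℝ) :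
    z ⬝ᵥ z = (z ∘ Sum.inl) ⬝ᵥ (z ∘ Sum.inl) + (z ∘ Sum.inr) ⬝ᵥ (z ∘ Sum.inr) := by
  simp [dotProduct]

/-- For `H ≠ 0` symmetric with spectral norm `L` and step size `η ∈ (0, 2/L)`,
the set of initial points `z⁰` in the unit ball of `ℝ^{2n}` from which the
projected gradient sequence (PG2) applied to (D') does not converge to a global
minimizer of (D') has Lebesgue measure zero. Here `ℝ^{2n}` is modeled as
`Fin n ⊕ Fin n → ℝ`, `A = diag(H, H)`, `a = (c, 0)` and
`f(z) = (1/2)zᵀAz + aᵀz`; one PG2 step maps `z` to `w / max{‖w‖, 1}` with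
`w = z − η(Az + a)`. The spectral norm `L = ‖H‖₂` is characterized by the
quadratic-form bound together with attainment at an eigenvector. -/
theorem stmt_6 {n : ℕ} (H : Matrix (Fin n) (Fin n) ℝ) (hH : H.IsSymm) (hH0 : H ≠ 0)
    (c : Fin n → ℝ) (L : ℝ)
    (hL1 : ∀ x : Fin n → ℝ, |x ⬝ᵥ (H *ᵥ x)| ≤ L * (x ⬝ᵥ x))
    (hL2 : ∃ v : Fin n → ℝ, v ≠ 0 ∧ (H *ᵥ v = L • v ∨ H *ᵥ v = (-L) • v))
    (η : ℝ) (hη0 : 0 < η) (hη2 : η < 2 / L)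
    (A : Matrix (Fin n ⊕ Fin n) (Fin n ⊕ Fin n) ℝ) (hA : A = Matrix.fromBlocks H 0 0 H)
    (a : Fin n ⊕ Fin n → ℝ) (ha : a = Sum.elim c 0)
    (f : (Fin n ⊕ Fin n → ℝ) → ℝ)
    (hf : ∀ z, f z = (1 / 2) * (z ⬝ᵥ (A *ᵥ z)) + a ⬝ᵥ z)
    (step : (Fin n ⊕ Fin n → ℝ) → (Fin n ⊕ Fin n → ℝ))
    (hstep : ∀ z, step z =
      (max (Real.sqrt ((z - η • (A *ᵥ z + a)) ⬝ᵥ (z - η • (A *ᵥ z + a)))) 1)⁻¹ •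
        (z - η • (A *ᵥ z + a))) :
    volume {z0 : Fin n ⊕ Fin n → ℝ | z0 ⬝ᵥ z0 ≤ 1 ∧
      ¬ ∃ zbar : Fin n ⊕ Fin n → ℝ,
          (zbar ⬝ᵥ zbar ≤ 1 ∧ ∀ z : Fin n ⊕ Fin n → ℝ, z ⬝ᵥ z ≤ 1 → f zbar ≤ f z) ∧
          Tendsto (fun k => step^[k] z0) atTop (nhds zbar)} = 0 := by
  have : Nonempty (Fin n) := by
    by_contra h
    rw [not_nonempty_iff] at h
    exact hH0 (Subsingleton.elim _ _)
  have hSsymm : (toEuclideanLin H).IsSymmetric :=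
    isSymmetric_toEuclideanLin_iff.2 (by rwa [IsHermitian, conjTranspose_eq_transpose_of_trivial])
  have hTsymm : (toEuclideanLin A).IsSymmetric :=
    isSymmetric_toEuclideanLin_iff.2 (by
      rw [hA, IsHermitian, conjTranspose_eq_transpose_of_trivial, fromBlocks_transpose, hH.eq]
      simp)
  obtain ⟨lam, v, hv0, hv, hlam⟩ := hSsymm.exists_eigenvector_forall_le
  have hlam' : ∀ x : Fin n → ℝ, lam * (x ⬝ᵥ x) ≤ (H *ᵥ x) ⬝ᵥ x := fun x => by
    simpa [EuclideanSpace.real_norm_sq_eq_dotProduct, EuclideanSpace.real_inner_eq_dotProduct]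
      using hlam (WithLp.toLp 2 x)
  have hHv : H *ᵥ v.ofLp = lam • v.ofLp := by
    simpa using congrArg WithLp.ofLp hv
  have hL' : ∀ x : Fin n → ℝ, (H *ᵥ x) ⬝ᵥ x ≤ L * (x ⬝ᵥ x) := fun x => by
    rw [dotProduct_comm]; exact (le_abs_self _).trans (hL1 x)
  have hLpos : 0 < L := by
    have h1 : 0 < 2 / L := hη0.trans hη2
    by_contra! h2
    exact h1.not_ge (div_nonpos_of_nonneg_of_nonpos two_pos.le h2)
  have hηL : η * L < 2 := (lt_div_iff₀ hLpos).1 hη2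
  set T := toEuclideanLin A
  have hT : ∀ x, (T x).ofLp = A *ᵥ x.ofLp := fun _ => rfl
  have hTL : ∀ x, inner ℝ (T x) x ≤ L * ‖x‖ ^ 2 := fun x => by
    rw [EuclideanSpace.real_norm_sq_eq_dotProduct, EuclideanSpace.real_inner_eq_dotProduct,
      hT, hA, fromBlocks_diag_mulVec_dotProduct, dotProduct_self_sum]
    linarith [hL' (x.ofLp ∘ Sum.inl), hL' (x.ofLp ∘ Sum.inr)]
  have hTlam : ∀ x, lam * ‖x‖ ^ 2 ≤ inner ℝ (T x) x := fun x => by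
    rw [EuclideanSpace.real_norm_sq_eq_dotProduct, EuclideanSpace.real_inner_eq_dotProduct,
      hT, hA, fromBlocks_diag_mulVec_dotProduct, dotProduct_self_sum]
    linarith [hlam' (x.ofLp ∘ Sum.inl), hlam' (x.ofLp ∘ Sum.inr)]
  set w : Fin n ⊕ Fin n → ℝ := Sum.elim 0 v.ofLp with hw
  have hw0 : w ≠ 0 := fun h => hv0 <| by
    ext i
    simpa [hw] using congrFun h (Sum.inr i)
  have hTw : T (WithLp.toLp 2 w) = lam • WithLp.toLp 2 w := by
    apply WithLp.ofLp_injective 2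
    rw [hT, hA, fromBlocks_mulVec]
    ext (i | i) <;> simp [hw, hHv]
  have hwa : inner ℝ (WithLp.toLp 2 w) (WithLp.toLp 2 a) = 0 := by
    rw [EuclideanSpace.real_inner_eq_dotProduct, ha, hw]
    simp [dotProduct]
  have hnorm : ∀ z : Fin n ⊕ Fin n → ℝ, ‖WithLp.toLp 2 z‖ ≤ 1 ↔ z ⬝ᵥ z ≤ 1 := fun z => by
    rw [← sq_le_one_iff₀ (norm_nonneg _), EuclideanSpace.real_norm_sq_eq_dotProduct]
  have hobj : ∀ z, quadObj T (WithLp.toLp 2 a) (WithLp.toLp 2 z) = f z := fun z => by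
    rw [hf, quadObj, EuclideanSpace.real_inner_eq_dotProduct,
      EuclideanSpace.real_inner_eq_dotProduct, hT, dotProduct_comm]
  have hsemi : Function.Semiconj (WithLp.toLp 2) step
      (projGradStep T (WithLp.toLp 2 a) η) := fun z => by
    have h1 : WithLp.toLp 2 z - η • (T (WithLp.toLp 2 z) + WithLp.toLp 2 a)
        = WithLp.toLp 2 (z - η • (A *ᵥ z + a)) := rfl
    rw [projGradStep, ballProj, h1, hstep, WithLp.toLp_smul,
      ← Real.sqrt_sq (norm_nonneg (WithLp.toLp 2 (z - η • (A *ᵥ z + a)))),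
      EuclideanSpace.real_norm_sq_eq_dotProduct]
  refine measure_mono_null (fun z₀ hz₀ => ?_) (volume_setOf_dotProduct_eq_zero hw0)
  by_contra hne
  obtain ⟨z, ⟨hz1, hzmin⟩, hz⟩ := exists_tendsto_projGradStep_iterate hTsymm hη0 hLpos hηL hTL
    hTw hwa hTlam ((hnorm z₀).2 hz₀.1)
    (by rwa [EuclideanSpace.real_inner_eq_dotProduct] : inner ℝ (WithLp.toLp 2 w) _ ≠ 0)
  refine hz₀.2 ⟨z.ofLp, ⟨(hnorm _).1 hz1, fun y hy => ?_⟩, ?_⟩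
  · rw [← hobj, ← hobj]
    exact hzmin _ ((hnorm y).2 hy)
  · have h1 := ((PiLp.continuous_ofLp 2 _).tendsto z).comp hz
    refine h1.congr fun k => ?_
    exact congrArg WithLp.ofLp (hsemi.iterate_right k z₀).symm
end

section
/- Assume H ≠ 0, let η ∈ (0, 2/L), and let z̄ ∈ B_{2n} be a stationary point of (D') with multiplier λ̄/2 (i.e., λ̄ ≥ 0, (A + λ̄I)z̄ + a = 0 and λ̄(z̄ᵀz̄ − 1) = 0) such that λ₁ + λ̄ < 0, where λ₁ is the smallest eigenvalue of H. Then there exists a nonzero vector v ∈ ℝ^{2n} with Av = λ₁v, vᵀa = 0 and vᵀz̄ = 0, such that for every initial point z⁰ ∈ B_{2n} with vᵀz⁰ ≠ 0, the (PG2) sequence starting from z⁰ does not converge to z̄. -/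
open Matrix Filter

/-- A nonzero real sequence that eventually does not decrease in absolute value cannot tend
to zero. -/
lemma not_tendsto_zero_of_eventually_abs_le_succ (g : ℕ → ℝ) (hg : ∀ k, g k ≠ 0)
    (hmono : ∀ᶠ k in atTop, |g k| ≤ |g (k + 1)|) : ¬ Tendsto g atTop (nhds 0) := by
  intro hlim
  obtain ⟨N, hN⟩ := eventually_atTop.1 hmono
  have hle : ∀ k, N ≤ k → |g N| ≤ |g k| := by
    intro k hk
    induction k, hk using Nat.le_induction with
    | base => exact le_rfl
    | succ k hk ih => exact ih.trans (hN k hk)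
  have habs : Tendsto (fun k => |g k|) atTop (nhds 0) := by simpa using hlim.abs
  have h0 : |g N| ≤ 0 := ge_of_tendsto habs (eventually_atTop.2 ⟨N, hle⟩)
  exact hg N (abs_eq_zero.1 (le_antisymm h0 (abs_nonneg _)))

/-- For a symmetric matrix, pairing the image with an eigenvector scales by the eigenvalue. -/
lemma Matrix.IsSymm.dotProduct_mulVec_of_eigenvector {ι R : Type*} [Fintype ι] [CommRing R]
    {M : Matrix ι ι R} (hM : M.IsSymm) {v : ι → R} {μ : R} (hv : M *ᵥ v = μ • v) (x : ι → R) :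
    v ⬝ᵥ (M *ᵥ x) = μ * (v ⬝ᵥ x) := by
  rw [dotProduct_mulVec, ← mulVec_transpose, hM.eq, hv, smul_dotProduct, smul_eq_mul]

/-- If `z̄` is a stationary point of (D') with multiplier `λ̄/2` such that
`λ₁ + λ̄ < 0` (where `λ₁` is the smallest eigenvalue of `H`), then there is a
nonzero vector `v` with `Av = λ₁v`, `vᵀa = 0` and `vᵀz̄ = 0` such that the PG2
sequence started from any feasible `z⁰` with `vᵀz⁰ ≠ 0` does not converge
to `z̄`. Here `A = diag(H, H)`, `a = (c, 0)`, one PG2 step maps `z` to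
`w / max{‖w‖, 1}` with `w = z − η(Az + a)`, `L = ‖H‖₂` is characterized by the
quadratic-form bound together with attainment at an eigenvector, and `λ₁` by an
eigenvector together with the Rayleigh bound. -/
theorem stmt_7 {n : ℕ} (H : Matrix (Fin n) (Fin n) ℝ) (hH : H.IsSymm) (hH0 : H ≠ 0)
    (c : Fin n → ℝ) (L : ℝ)
    (hL1 : ∀ x : Fin n → ℝ, |x ⬝ᵥ (H *ᵥ x)| ≤ L * (x ⬝ᵥ x))
    (hL2 : ∃ v : Fin n → ℝ, v ≠ 0 ∧ (H *ᵥ v = L • v ∨ H *ᵥ v = (-L) • v))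
    (lam1 : ℝ) (hev : ∃ v : Fin n → ℝ, v ≠ 0 ∧ H *ᵥ v = lam1 • v)
    (hray : ∀ x : Fin n → ℝ, lam1 * (x ⬝ᵥ x) ≤ x ⬝ᵥ (H *ᵥ x))
    (η : ℝ) (hη0 : 0 < η) (hη2 : η < 2 / L)
    (A : Matrix (Fin n ⊕ Fin n) (Fin n ⊕ Fin n) ℝ) (hA : A = Matrix.fromBlocks H 0 0 H)
    (a : Fin n ⊕ Fin n → ℝ) (ha : a = Sum.elim c 0)
    (step : (Fin n ⊕ Fin n → ℝ) → (Fin n ⊕ Fin n → ℝ))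
    (hstep : ∀ z, step z =
      (max (Real.sqrt ((z - η • (A *ᵥ z + a)) ⬝ᵥ (z - η • (A *ᵥ z + a)))) 1)⁻¹ •
        (z - η • (A *ᵥ z + a)))
    (zbar : Fin n ⊕ Fin n → ℝ) (hzbar : zbar ⬝ᵥ zbar ≤ 1)
    (lambar : ℝ) (hlambar : 0 ≤ lambar)
    (h1 : (A + lambar • (1 : Matrix (Fin n ⊕ Fin n) (Fin n ⊕ Fin n) ℝ)) *ᵥ zbar + a = 0)
    (h2 : lambar * (zbar ⬝ᵥ zbar - 1) = 0)
    (hneg : lam1 + lambar < 0) :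
    ∃ v : Fin n ⊕ Fin n → ℝ, v ≠ 0 ∧ A *ᵥ v = lam1 • v ∧ v ⬝ᵥ a = 0 ∧ v ⬝ᵥ zbar = 0 ∧
      ∀ z0 : Fin n ⊕ Fin n → ℝ, z0 ⬝ᵥ z0 ≤ 1 → v ⬝ᵥ z0 ≠ 0 →
        ¬ Tendsto (fun k => step^[k] z0) atTop (nhds zbar) := by
  obtain ⟨u, hu0, hu⟩ := hev
  have hAsymm : A.IsSymm := by
    rw [hA]
    exact Matrix.IsSymm.fromBlocks hH (by simp) hH
  have hAv : A *ᵥ (Sum.elim 0 u : Fin n ⊕ Fin n → ℝ) =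
      lam1 • (Sum.elim 0 u : Fin n ⊕ Fin n → ℝ) := by
    rw [hA, fromBlocks_mulVec]
    ext i
    rcases i with i | i <;> simp [hu]
  have hv0 : (Sum.elim 0 u : Fin n ⊕ Fin n → ℝ) ≠ 0 := by
    intro h
    exact hu0 (funext fun i => by simpa using congrFun h (Sum.inr i))
  have hva : (Sum.elim 0 u : Fin n ⊕ Fin n → ℝ) ⬝ᵥ a = 0 := by
    simp [ha]
  generalize (Sum.elim 0 u : Fin n ⊕ Fin n → ℝ) = v at hAv hv0 hva
  have hpair := hAsymm.dotProduct_mulVec_of_eigenvector hAv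
  have hvz : v ⬝ᵥ zbar = 0 := by
    have h := congrArg (fun w => v ⬝ᵥ w) h1
    simp only [add_mulVec, smul_mulVec, one_mulVec, dotProduct_add, dotProduct_smul,
      hpair, hva, dotProduct_zero, smul_eq_mul, add_zero] at h
    rw [← add_mul] at h
    exact (mul_eq_zero.1 h).resolve_left hneg.ne
  refine ⟨v, hv0, hAv, hva, hvz, fun z0 _ hvz0 hlim => ?_⟩
  let d : (Fin n ⊕ Fin n → ℝ) → ℝ := fun z =>
    max (Real.sqrt ((z - η • (A *ᵥ z + a)) ⬝ᵥ (z - η • (A *ᵥ z + a)))) 1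
  have hd1 : ∀ z, 1 ≤ d z := fun z => le_max_right _ _
  have hdcont : Continuous d := by
    have hw : Continuous fun z : Fin n ⊕ Fin n → ℝ => z - η • (A *ᵥ z + a) := by fun_prop
    exact (Real.continuous_sqrt.comp (hw.dotProduct hw)).max continuous_const
  have hvstep : ∀ z, v ⬝ᵥ step z = (d z)⁻¹ * ((1 - η * lam1) * (v ⬝ᵥ z)) := by
    intro z
    have hw : v ⬝ᵥ (z - η • (A *ᵥ z + a)) = (1 - η * lam1) * (v ⬝ᵥ z) := by
      rw [dotProduct_sub, dotProduct_smul, dotProduct_add, hpair, hva, smul_eq_mul]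
      ring
    rw [hstep, dotProduct_smul, hw, smul_eq_mul]
  have hηlam : η * lambar < -(η * lam1) := by nlinarith
  have hηlambar : 0 ≤ η * lambar := mul_nonneg hη0.le hlambar
  have hdbar : d zbar < 1 - η * lam1 := by
    have hgrad : A *ᵥ zbar + a = -(lambar • zbar) := by
      rw [add_mulVec, smul_mulVec, one_mulVec] at h1
      rw [eq_neg_iff_add_eq_zero, ← h1]
      abel
    have hw : zbar - η • (A *ᵥ zbar + a) = (1 + η * lambar) • zbar := by
      rw [hgrad]
      module
    refine max_lt (lt_of_le_of_lt (Real.sqrt_le_iff.2 ⟨?_, ?_⟩)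
      (by linarith : 1 + η * lambar < 1 - η * lam1)) (by linarith)
    · linarith
    · rw [hw, smul_dotProduct, dotProduct_smul, smul_eq_mul, smul_eq_mul]
      nlinarith [mul_le_mul_of_nonneg_left hzbar (sq_nonneg (1 + η * lambar))]
  have hsucc : ∀ k, v ⬝ᵥ step^[k + 1] z0 =
      (d (step^[k] z0))⁻¹ * ((1 - η * lam1) * (v ⬝ᵥ step^[k] z0)) := by
    intro k
    rw [Function.iterate_succ_apply', hvstep]
  refine not_tendsto_zero_of_eventually_abs_le_succ (fun k => v ⬝ᵥ step^[k] z0) ?_ ?_ ?_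
  · intro k
    induction k with
    | zero => exact hvz0
    | succ k ih =>
      have hd := hd1 (step^[k] z0)
      simp only [hsucc]
      exact mul_ne_zero (inv_ne_zero (by linarith)) (mul_ne_zero (by linarith) ih)
  · filter_upwards [((hdcont.tendsto zbar).comp hlim).eventually_lt_const hdbar] with k hk
    have hd := hd1 (step^[k] z0)
    have hdpos : 0 < d (step^[k] z0) := by linarith
    rw [hsucc, ← mul_assoc, abs_mul]
    refine le_mul_of_one_le_left (abs_nonneg _) (le_trans ?_ (le_abs_self _))
    rw [inv_mul_eq_div, one_le_div hdpos]
    exact hk.le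
  · have hcont : Continuous fun z : Fin n ⊕ Fin n → ℝ => v ⬝ᵥ z := by fun_prop
    simpa only [hvz, Function.comp_def] using (hcont.tendsto zbar).comp hlim
end

section
/- The set of values λ ≥ 0 for which there exists z ∈ B_{2n} that is a stationary point of (D') with multiplier λ/2 (i.e., (A + λI)z + a = 0 and λ(zᵀz − 1) = 0) but is not a global minimizer of (D') is a finite set. -/
open Matrix

section SecularEquation

variable {ι : Type*} [Fintype ι] [DecidableEq ι]

/-- The secular polynomial of `(A + X) z + a = 0`, `z ⬝ᵥ z = 1`, with denominators cleared. -/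
noncomputable def secularPolynomial (A : Matrix ι ι ℝ) (a : ι → ℝ) : Polynomial ℝ :=
  ∑ i, (∑ j, (charmatrix (-A)).adjugate i j * Polynomial.C (a j)) ^ 2 - (-A).charpoly ^ 2

lemma map_eval_charmatrix_neg (A : Matrix ι ι ℝ) (t : ℝ) :
    (Polynomial.evalRingHom t).mapMatrix (charmatrix (-A)) = A + t • (1 : Matrix ι ι ℝ) := by
  ext i j
  by_cases h : i = j
  · subst h
    simp [add_comm]
  · simp [h]

lemma eval_charpoly_neg (A : Matrix ι ι ℝ) (t : ℝ) :
    (-A).charpoly.eval t = (A + t • (1 : Matrix ι ι ℝ)).det := by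
  rw [← map_eval_charmatrix_neg, ← RingHom.map_det]
  rfl

lemma eval_secularPolynomial (A : Matrix ι ι ℝ) (a : ι → ℝ) (t : ℝ) :
    (secularPolynomial A a).eval t =
      ((A + t • (1 : Matrix ι ι ℝ)).adjugate *ᵥ a) ⬝ᵥ ((A + t • (1 : Matrix ι ι ℝ)).adjugate *ᵥ a)
        - (A + t • (1 : Matrix ι ι ℝ)).det ^ 2 := by
  have hadj : ∀ i j, ((charmatrix (-A)).adjugate i j).eval t =
      (A + t • (1 : Matrix ι ι ℝ)).adjugate i j := by
    intro i j
    rw [← map_eval_charmatrix_neg, ← RingHom.map_adjugate]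
    rfl
  simp only [secularPolynomial, Polynomial.eval_sub, eval_charpoly_neg,
    Polynomial.eval_finsetSum, Polynomial.eval_mul, Polynomial.eval_C, hadj, dotProduct, mulVec,
    sq]

lemma adjugate_mulVec_of_mulVec_add_eq_zero {M : Matrix ι ι ℝ} {a z : ι → ℝ}
    (h : M *ᵥ z + a = 0) : M.adjugate *ᵥ a = -(M.det • z) := by
  rw [eq_neg_of_add_eq_zero_right h, mulVec_neg, mulVec_mulVec, adjugate_mul, smul_mulVec,
    one_mulVec]

lemma le_of_stationary_of_dotProduct_eq_one {A : Matrix ι ι ℝ} {a z : ι → ℝ} {t : ℝ}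
    (h : (A + t • (1 : Matrix ι ι ℝ)) *ᵥ z + a = 0) (hz : z ⬝ᵥ z = 1) :
    t ≤ ∑ i, (∑ j, |A i j| + |a i|) := by
  have hle : ∀ i, |z i| ≤ 1 := by
    intro i
    rw [← sq_le_one_iff_abs_le_one, ← hz, sq]
    exact Finset.single_le_sum (f := fun i => z i * z i) (fun j _ => mul_self_nonneg _)
      (Finset.mem_univ i)
  have hi : ∀ i, t * z i = -((A *ᵥ z) i + a i) := by
    intro i
    have := congrFun h i
    simp only [add_mulVec, smul_mulVec, one_mulVec, Pi.add_apply, Pi.smul_apply, smul_eq_mul,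
      Pi.zero_apply] at this
    linarith
  calc t = ∑ i, (t * z i) * z i := by
        simp only [mul_assoc, ← Finset.mul_sum]
        rw [show ∑ i, z i * z i = 1 from hz, mul_one]
    _ ≤ ∑ i, (∑ j, |A i j| + |a i|) := by
        refine Finset.sum_le_sum fun i _ => ?_
        have hA : |(A *ᵥ z) i| ≤ ∑ j, |A i j| := by
          refine (Finset.abs_sum_le_sum_abs _ _).trans (Finset.sum_le_sum fun j _ => ?_)
          rw [abs_mul]
          exact mul_le_of_le_one_right (abs_nonneg _) (hle j)
        calc (t * z i) * z i ≤ |t * z i| * |z i| := by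
              rw [← abs_mul]
              exact le_abs_self _
          _ ≤ |t * z i| := mul_le_of_le_one_right (abs_nonneg _) (hle i)
          _ ≤ |(A *ᵥ z) i| + |a i| := by
              rw [hi, abs_neg]
              exact abs_add_le _ _
          _ ≤ ∑ j, |A i j| + |a i| := by gcongr

lemma secularPolynomial_ne_zero (A : Matrix ι ι ℝ) (a : ι → ℝ) :
    secularPolynomial A a ≠ 0 := by
  intro hP
  have hfin : {t : ℝ | (-A).charpoly.IsRoot t}.Finite :=
    Polynomial.finite_setOfPred_isRoot (charpoly_monic (-A)).ne_zero
  obtain ⟨t, ht, hroot⟩ :=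
    ((Set.Ioi_infinite (∑ i, (∑ j, |A i j| + |a i|))).sdiff hfin).nonempty
  set M := A + t • (1 : Matrix ι ι ℝ) with hM
  have hdet : M.det ≠ 0 := by
    rw [hM, ← eval_charpoly_neg]
    exact hroot
  have heval := eval_secularPolynomial A a t
  rw [hP, Polynomial.eval_zero, ← hM] at heval
  have hstat : M *ᵥ (-(M⁻¹ *ᵥ a)) + a = 0 := by
    rw [mulVec_neg, mulVec_mulVec, mul_nonsing_inv _ (isUnit_iff_ne_zero.mpr hdet), one_mulVec,
      neg_add_cancel]
  rw [adjugate_mulVec_of_mulVec_add_eq_zero hstat, neg_dotProduct_neg, smul_dotProduct,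
    dotProduct_smul, smul_eq_mul, smul_eq_mul] at heval
  have hunit : (-(M⁻¹ *ᵥ a)) ⬝ᵥ (-(M⁻¹ *ᵥ a)) = 1 := by
    have : M.det ^ 2 ≠ 0 := pow_ne_zero 2 hdet
    apply mul_left_cancel₀ this
    linarith
  exact absurd (le_of_stationary_of_dotProduct_eq_one hstat hunit) (not_le.mpr ht)

lemma isRoot_secularPolynomial {A : Matrix ι ι ℝ} {a z : ι → ℝ} {t : ℝ}
    (h : (A + t • (1 : Matrix ι ι ℝ)) *ᵥ z + a = 0) (hz : z ⬝ᵥ z = 1) :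
    (secularPolynomial A a).IsRoot t := by
  rw [Polynomial.IsRoot, eval_secularPolynomial, adjugate_mulVec_of_mulVec_add_eq_zero h,
    neg_dotProduct_neg, smul_dotProduct, dotProduct_smul, hz, smul_eq_mul, smul_eq_mul]
  ring

end SecularEquation

/-- The set of values `λ ≥ 0` serving as KKT multipliers (times 2) at stationary
points of (D') that are not global minimizers of (D') is finite. Here
`A = diag(H, H)`, `a = (c, 0)` and `f(z) = (1/2)zᵀAz + aᵀz` on
`ℝ^{2n} = (Fin n ⊕ Fin n) → ℝ`. -/
theorem stmt_9 {n : ℕ} (H : Matrix (Fin n) (Fin n) ℝ) (hH : H.IsSymm)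
    (c : Fin n → ℝ)
    (A : Matrix (Fin n ⊕ Fin n) (Fin n ⊕ Fin n) ℝ) (hA : A = Matrix.fromBlocks H 0 0 H)
    (a : Fin n ⊕ Fin n → ℝ) (ha : a = Sum.elim c 0)
    (f : (Fin n ⊕ Fin n → ℝ) → ℝ)
    (hf : ∀ z, f z = (1 / 2) * (z ⬝ᵥ (A *ᵥ z)) + a ⬝ᵥ z) :
    {lam : ℝ | 0 ≤ lam ∧ ∃ z : Fin n ⊕ Fin n → ℝ, z ⬝ᵥ z ≤ 1 ∧
      (A + lam • (1 : Matrix (Fin n ⊕ Fin n) (Fin n ⊕ Fin n) ℝ)) *ᵥ z + a = 0 ∧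
      lam * (z ⬝ᵥ z - 1) = 0 ∧
      ¬ ∀ z' : Fin n ⊕ Fin n → ℝ, z' ⬝ᵥ z' ≤ 1 → f z ≤ f z'}.Finite := by
  refine ((Set.finite_singleton (0 : ℝ)).union
    (Polynomial.finite_setOfPred_isRoot (secularPolynomial_ne_zero A a))).subset ?_
  rintro t ⟨-, z, -, hstat, hcompl, -⟩
  rcases mul_eq_zero.mp hcompl with h | h
  · exact Or.inl h
  · exact Or.inr (isRoot_secularPolynomial hstat (sub_eq_zero.mp h))
end

section
/- Let Q ⊆ ℝⁿ be nonempty, let h : ℝⁿ → ℝ be differentiable with ∇h Lipschitz continuous with constant L > 0, and let η ∈ (0, 1/L]. Let x ∈ Q, s = x − η∇h(x), and let x⁺ ∈ Q satisfy ‖x⁺ − s‖ ≤ ‖y − s‖ for all y ∈ Q (i.e., x⁺ is a metric projection of s onto Q). Then h(x⁺) − h(x) ≤ (1/(2η))(‖x⁺ − s‖² − ‖x − s‖²) ≤ 0. -/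
/-- Descent lemma: a differentiable function whose gradient is `L`-Lipschitz lies below its
quadratic upper model. -/
theorem le_quadratic_of_lipschitzWith_gradient {F : Type*} [NormedAddCommGroup F]
    [InnerProductSpace ℝ F] [CompleteSpace F] {h : F → ℝ} (hd : Differentiable ℝ h)
    {L : NNReal} (hLip : LipschitzWith L (fun x => gradient h x)) (x y : F) :
    h y ≤ h x + inner ℝ (gradient h x) (y - x) + L / 2 * ‖y - x‖ ^ 2 := by
  set d := y - x with hd_def
  let φ : ℝ → ℝ := fun t =>
    h (x + t • d) - t * inner ℝ (gradient h x) d - L / 2 * ‖d‖ ^ 2 * t ^ 2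
  have hφ (t : ℝ) : HasDerivAt φ (inner ℝ (gradient h (x + t • d)) d
      - inner ℝ (gradient h x) d - L * ‖d‖ ^ 2 * t) t := by
    have hline : HasDerivAt (fun t : ℝ => x + t • d) d t := by
      simpa using ((hasDerivAt_id t).smul_const d).const_add x
    have hcomp : HasDerivAt (fun t : ℝ => h (x + t • d))
        (inner ℝ (gradient h (x + t • d)) d) t := by
      exact (hd (x + t • d)).hasGradientAt.hasFDerivAt.comp_hasDerivAt t hline
    refine ((hcomp.sub ((hasDerivAt_id t).mul_const _)).sub
      ((hasDerivAt_pow 2 t).const_mul _)).congr_deriv ?_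
    norm_num
    ring
  have hanti : AntitoneOn φ (Set.Icc 0 1) := by
    refine antitoneOn_of_deriv_nonpos (convex_Icc 0 1)
      (fun t _ => (hφ t).continuousAt.continuousWithinAt)
      (fun t _ => (hφ t).differentiableAt.differentiableWithinAt) fun t ht => ?_
    rw [interior_Icc] at ht
    rw [(hφ t).deriv, ← inner_sub_left, sub_nonpos]
    calc inner ℝ (gradient h (x + t • d) - gradient h x) d
        ≤ ‖gradient h (x + t • d) - gradient h x‖ * ‖d‖ := real_inner_le_norm _ _
      _ ≤ (L * ‖x + t • d - x‖) * ‖d‖ := by gcongr; exact hLip.norm_sub_le _ _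
      _ = L * ‖d‖ ^ 2 * t := by
        rw [add_sub_cancel_left, norm_smul, Real.norm_of_nonneg ht.1.le]
        ring
  have h01 := hanti (Set.left_mem_Icc.2 zero_le_one) (Set.right_mem_Icc.2 zero_le_one) zero_le_one
  simp only [φ, zero_smul, add_zero, one_smul, hd_def, add_sub_cancel] at h01
  linarith

/-- Sufficient decrease of a projected gradient step: if `∇h` is `L`-Lipschitz,
`η ∈ (0, 1/L]`, `x ∈ Q`, `s = x − η∇h(x)` and `x⁺` is a metric projection of `s`
onto `Q`, then `h(x⁺) − h(x) ≤ (1/(2η))(‖x⁺ − s‖² − ‖x − s‖²) ≤ 0`. -/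
theorem stmt_11 {n : ℕ} (Q : Set (EuclideanSpace ℝ (Fin n)))
    (h : EuclideanSpace ℝ (Fin n) → ℝ) (hd : Differentiable ℝ h)
    (L : ℝ) (hL : 0 < L)
    (hLip : LipschitzWith L.toNNReal (fun x => gradient h x))
    (η : ℝ) (hη0 : 0 < η) (hη1 : η ≤ 1 / L)
    (x : EuclideanSpace ℝ (Fin n)) (hx : x ∈ Q)
    (s : EuclideanSpace ℝ (Fin n)) (hs : s = x - η • gradient h x)
    (xp : EuclideanSpace ℝ (Fin n)) (hxp : xp ∈ Q)
    (hproj : ∀ y ∈ Q, ‖xp - s‖ ≤ ‖y - s‖) :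
    h xp - h x ≤ (1 / (2 * η)) * (‖xp - s‖ ^ 2 - ‖x - s‖ ^ 2) ∧
      (1 / (2 * η)) * (‖xp - s‖ ^ 2 - ‖x - s‖ ^ 2) ≤ 0 := by
  have hmodel : (1 / (2 * η)) * (‖xp - s‖ ^ 2 - ‖x - s‖ ^ 2)
      = inner ℝ (gradient h x) (xp - x) + 1 / (2 * η) * ‖xp - x‖ ^ 2 := by
    have hxs : x - s = η • gradient h x := by rw [hs, sub_sub_cancel]
    have hxps : xp - s = (xp - x) + η • gradient h x := by rw [← hxs, sub_add_sub_cancel]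
    rw [hxps, hxs, norm_add_sq_real, real_inner_smul_right,
      real_inner_comm (gradient h x) (xp - x)]
    field_simp
    ring
  constructor
  · have hdesc := le_quadratic_of_lipschitzWith_gradient hd hLip x xp
    rw [Real.coe_toNNReal L hL.le] at hdesc
    have hcoef : L / 2 ≤ 1 / (2 * η) := by
      rw [le_div_iff₀ hL] at hη1
      rw [div_le_div_iff₀ two_pos (by positivity)]
      linarith
    have hquad := mul_le_mul_of_nonneg_right hcoef (sq_nonneg ‖xp - x‖)
    rw [hmodel]
    linarith
  · have hsq : ‖xp - s‖ ^ 2 ≤ ‖x - s‖ ^ 2 := by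
      gcongr
      exact hproj x hx
    exact mul_nonpos_of_nonneg_of_nonpos (by positivity) (sub_nonpos.2 hsq)
end

section
/- Let h, g : ℝⁿ → ℝ be continuously differentiable, let Q = {x ∈ ℝⁿ : g(x) = 0} be nonempty and compact with ∇g(x) ≠ 0 for all x ∈ Q, suppose ∇h is Lipschitz continuous with constant L > 0, and let η ∈ (0, 1/L]. Let {x^k} be a sequence with x⁰ ∈ Q and, for each k, x^{k+1} ∈ Q satisfying ‖x^{k+1} − s^k‖ ≤ ‖y − s^k‖ for all y ∈ Q, where s^k = x^k − η∇h(x^k). Then every accumulation point x̄ of {x^k} satisfies g(x̄) = 0 and ∇h(x̄) + μ∇g(x̄) = 0 for some μ ∈ ℝ. -/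
open Filter

/-- The descent lemma: a differentiable function with `L`-Lipschitz gradient lies below its
quadratic model at every point. -/
theorem le_add_inner_gradient_add_sq_of_lipschitz {E : Type*} [NormedAddCommGroup E]
    [InnerProductSpace ℝ E] [CompleteSpace E] {f : E → ℝ} (hf : Differentiable ℝ f) {L : ℝ}
    (hL : 0 ≤ L) (hLip : LipschitzWith L.toNNReal (fun x => gradient f x)) (x d : E) :
    f (x + d) ≤ f x + inner ℝ (gradient f x) d + L / 2 * ‖d‖ ^ 2 := by
  have hder : ∀ t : ℝ, HasDerivAt
      (fun t : ℝ => f (x + t • d) - t * inner ℝ (gradient f x) d - L / 2 * ‖d‖ ^ 2 * t ^ 2)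
      (inner ℝ (gradient f (x + t • d) - gradient f x) d - L * ‖d‖ ^ 2 * t) t := by
    intro t
    have hline : HasDerivAt (fun t : ℝ => x + t • d) d t := by
      simpa using ((hasDerivAt_id t).smul_const d).const_add x
    have hcomp := ((hf (x + t • d)).hasGradientAt.hasFDerivAt).comp_hasDerivAt t hline
    rw [InnerProductSpace.toDual_apply_apply] at hcomp
    have hlin := (hasDerivAt_id t).mul_const (inner ℝ (gradient f x) d)
    have hsq := ((hasDerivAt_id t).pow 2).const_mul (L / 2 * ‖d‖ ^ 2)
    refine ((hcomp.sub hlin).sub hsq).congr_deriv ?_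
    rw [inner_sub_left]
    simp
    ring
  have hanti := antitoneOn_of_deriv_nonpos (convex_Icc (0 : ℝ) 1)
    (fun t _ => (hder t).continuousAt.continuousWithinAt)
    (fun t _ => (hder t).differentiableAt.differentiableWithinAt)
    (fun t ht => by
      rw [interior_Icc] at ht
      rw [(hder t).deriv, sub_nonpos]
      have hlip := hLip.dist_le_mul (x + t • d) x
      rw [Real.coe_toNNReal L hL, dist_eq_norm, dist_eq_norm, add_sub_cancel_left, norm_smul,
        Real.norm_of_nonneg ht.1.le] at hlip
      calc inner ℝ (gradient f (x + t • d) - gradient f x) d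
          ≤ ‖gradient f (x + t • d) - gradient f x‖ * ‖d‖ := real_inner_le_norm _ _
        _ ≤ L * (t * ‖d‖) * ‖d‖ := by gcongr
        _ = L * ‖d‖ ^ 2 * t := by ring)
  have hle := hanti (Set.left_mem_Icc.2 zero_le_one) (Set.right_mem_Icc.2 zero_le_one) zero_le_one
  simp only [one_smul, zero_smul, add_zero] at hle
  linarith

/-- If the step size is at most `1 / L`, the change of `f` is controlled by the change of the
squared distance to the gradient step. -/
theorem two_mul_sub_le_sq_dist_gradient_step {E : Type*} [NormedAddCommGroup E]
    [InnerProductSpace ℝ E] [CompleteSpace E] {f : E → ℝ} (hf : Differentiable ℝ f) {L : ℝ}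
    (hL : 0 < L) (hLip : LipschitzWith L.toNNReal (fun x => gradient f x)) {η : ℝ} (hη0 : 0 < η)
    (hη1 : η ≤ 1 / L) (x y : E) :
    2 * η * (f y - f x) ≤
      ‖y - (x - η • gradient f x)‖ ^ 2 - ‖x - (x - η • gradient f x)‖ ^ 2 := by
  have hdesc := le_add_inner_gradient_add_sq_of_lipschitz hf hL.le hLip x (y - x)
  rw [add_sub_cancel] at hdesc
  have hexp : ‖y - (x - η • gradient f x)‖ ^ 2 - ‖x - (x - η • gradient f x)‖ ^ 2 =
      ‖y - x‖ ^ 2 + 2 * η * inner ℝ (gradient f x) (y - x) := by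
    rw [← sub_add, ← sub_add, norm_add_sq_real, sub_self, zero_add, inner_smul_right,
      real_inner_comm]
    ring
  have hηL : η * L ≤ 1 := (le_div_iff₀ hL).1 hη1
  rw [hexp]
  nlinarith [mul_le_mul_of_nonneg_left hdesc (by positivity : 0 ≤ 2 * η),
    mul_le_mul_of_nonneg_right hηL (sq_nonneg ‖y - x‖)]

/-- If `x` is a nearest point to `s` on a regular level set of `g`, then `x - s` is a multiple of
the gradient of `g` at `x`. -/
theorem exists_sub_eq_smul_gradient_of_nearest {E : Type*} [NormedAddCommGroup E]
    [InnerProductSpace ℝ E] [CompleteSpace E] {g : E → ℝ} (hg : ContDiff ℝ 1 g) {x s : E}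
    (hgrad : gradient g x ≠ 0) (hmin : ∀ y, g y = g x → ‖x - s‖ ≤ ‖y - s‖) :
    ∃ c : ℝ, x - s = c • gradient g x := by
  have hextr : IsLocalExtrOn (fun y => ‖y - s‖ ^ 2) {y | g y = g x} x := by
    refine Or.inl (IsMinOn.localize fun y hy => ?_)
    have := hmin y hy
    simp only [Set.mem_ofPred_eq]
    gcongr
  have hg' : HasStrictFDerivAt g (InnerProductSpace.toDual ℝ E (gradient g x)) x := by
    have hstrict := hg.contDiffAt.hasStrictFDerivAt (x := x) one_ne_zero
    rwa [← (hg.differentiable one_ne_zero x).hasGradientAt.hasFDerivAt.fderiv]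
  have hsq := (hasStrictFDerivAt_norm_sq (x - s)).comp x ((hasStrictFDerivAt_id x).sub_const s)
  obtain ⟨a, b, hab, hsum⟩ := hextr.exists_multipliers_of_hasStrictFDerivAt_1d hg' hsq
  have hvec : a • gradient g x + (2 * b) • (x - s) = 0 := by
    refine ext_inner_right ℝ fun v => ?_
    have := DFunLike.congr_fun hsum v
    simp [inner_add_left, inner_smul_left, inner_sub_left] at this ⊢
    linarith
  have hb : b ≠ 0 := by
    rintro rfl
    simp [hgrad] at hvec
    simp [hvec] at hab
  refine ⟨-(a / (2 * b)), ?_⟩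
  have hb2 : 2 * b ≠ 0 := by positivity
  rw [add_comm, add_eq_zero_iff_eq_neg] at hvec
  rw [← inv_smul_smul₀ hb2 (x - s), hvec, smul_neg, smul_smul, neg_smul, inv_mul_eq_div]

/-- Every accumulation point of the generalized projected gradient sequence on
the compact set `Q = {x : g(x) = 0}` (with `∇g ≠ 0` on `Q`) is a stationary
(KKT) point of `min{h(x) : g(x) = 0}`. -/
theorem stmt_12 {n : ℕ} (h g : EuclideanSpace ℝ (Fin n) → ℝ)
    (hh : ContDiff ℝ 1 h) (hg : ContDiff ℝ 1 g)
    (Q : Set (EuclideanSpace ℝ (Fin n))) (hQ : Q = {x | g x = 0})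
    (hQne : Q.Nonempty) (hQc : IsCompact Q)
    (hgrad : ∀ x ∈ Q, gradient g x ≠ 0)
    (L : ℝ) (hL : 0 < L)
    (hLip : LipschitzWith L.toNNReal (fun x => gradient h x))
    (η : ℝ) (hη0 : 0 < η) (hη1 : η ≤ 1 / L)
    (x : ℕ → EuclideanSpace ℝ (Fin n)) (hx0 : x 0 ∈ Q)
    (hiter : ∀ k : ℕ, x (k + 1) ∈ Q ∧ ∀ y ∈ Q,
      ‖x (k + 1) - (x k - η • gradient h (x k))‖ ≤ ‖y - (x k - η • gradient h (x k))‖)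
    (xbar : EuclideanSpace ℝ (Fin n)) (hacc : MapClusterPt xbar atTop x) :
    g xbar = 0 ∧ ∃ μ : ℝ, gradient h xbar + μ • gradient g xbar = 0 := by
  have hmem : ∀ k, x k ∈ Q := fun k => k.casesOn hx0 fun k => (hiter k).1
  have hd : Differentiable ℝ h := hh.differentiable one_ne_zero
  obtain ⟨φ, hφ, hlim⟩ := hacc.tendsto_subseq
  have hbar : xbar ∈ Q := hQc.isClosed.mem_of_tendsto hlim (Eventually.of_forall fun k => hmem (φ k))
  have hstep : ∀ k, ∀ y ∈ Q, 2 * η * (h (x (k + 1)) - h (x k)) ≤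
      ‖y - (x k - η • gradient h (x k))‖ ^ 2 - ‖x k - (x k - η • gradient h (x k))‖ ^ 2 := by
    intro k y hy
    refine (two_mul_sub_le_sq_dist_gradient_step hd hL hLip hη0 hη1 (x k) (x (k + 1))).trans ?_
    have := (hiter k).2 y hy
    gcongr
  have hanti : Antitone fun k => h (x k) := antitone_nat_of_succ_le fun k => by
    have := hstep k (x k) (hmem k)
    rw [sub_self] at this
    exact sub_nonpos.1 (nonpos_of_mul_nonpos_right this (by positivity))
  have hval : Tendsto (fun k => h (x k)) atTop (nhds (h xbar)) :=
    (tendsto_iff_tendsto_subseq_of_antitone hanti hφ.tendsto_atTop).2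
      ((hd.continuous.tendsto xbar).comp hlim)
  have hdiff : Tendsto (fun k => 2 * η * (h (x (φ k + 1)) - h (x (φ k)))) atTop (nhds 0) := by
    simpa using ((((tendsto_add_atTop_iff_nat 1).2 hval).sub hval).comp
      hφ.tendsto_atTop).const_mul (2 * η)
  have hgcont : Continuous fun z => gradient h z := hLip.continuous
  have hnear : ∀ y ∈ Q, ‖xbar - (xbar - η • gradient h xbar)‖ ≤
      ‖y - (xbar - η • gradient h xbar)‖ := by
    intro y hy
    have hcont : Continuous fun z => ‖y - (z - η • gradient h z)‖ ^ 2 -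
        ‖z - (z - η • gradient h z)‖ ^ 2 := by fun_prop
    have := le_of_tendsto_of_tendsto' hdiff ((hcont.tendsto xbar).comp hlim)
      fun k => hstep (φ k) y hy
    exact le_of_sq_le_sq (sub_nonneg.1 this) (norm_nonneg _)
  have hg0 : g xbar = 0 := by simpa [hQ] using hbar
  refine ⟨hg0, ?_⟩
  obtain ⟨c, hc⟩ := exists_sub_eq_smul_gradient_of_nearest hg (hgrad xbar hbar)
    fun y hy => hnear y (by simpa [hQ, hg0] using hy)
  refine ⟨-(η⁻¹ * c), ?_⟩
  rw [sub_sub_cancel] at hc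
  rw [neg_smul, ← smul_smul, ← hc, inv_smul_smul₀ hη0.ne', add_neg_cancel]
end

section
/- Assume H ≠ 0 and let η ∈ (0, 1/L]. There exist finitely many nonzero vectors v₁, …, v_m ∈ ℝ^{2n} such that for every initial point z⁰ ∈ ∂B_{2n} with v_iᵀz⁰ ≠ 0 for all i = 1, …, m and for which w^k ≠ 0 for all k (so that the (PGe2) sequence is well-defined), the sequence {z^k} converges to a global minimizer of (De), i.e., to a point z̄ ∈ ∂B_{2n} with f(z̄) ≤ f(z) for all z ∈ ∂B_{2n}. -/
open Matrix Filter

section ProjectedGradient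

variable {ι : Type*} [Fintype ι]

lemma dotProduct_sq_le (v z : ι → ℝ) : (v ⬝ᵥ z) ^ 2 ≤ (v ⬝ᵥ v) * (z ⬝ᵥ z) := by
  simpa [dotProduct, pow_two] using Finset.sum_mul_sq_le_sq_mul_sq Finset.univ v z

lemma zero_le_dotProduct_self (v : ι → ℝ) : 0 ≤ v ⬝ᵥ v :=
  Finset.sum_nonneg fun i _ => mul_self_nonneg (v i)

lemma isCompact_dotProduct_self_eq_one : IsCompact {z : ι → ℝ | z ⬝ᵥ z = 1} := by
  refine Metric.isCompact_of_isClosed_isBounded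
    (isClosed_eq (continuous_id.dotProduct continuous_id) continuous_const) ?_
  refine (Metric.isBounded_closedBall (x := (0 : ι → ℝ)) (r := 1)).subset fun z hz => ?_
  rw [mem_closedBall_zero_iff, pi_norm_le_iff_of_nonneg zero_le_one]
  intro i
  have h : z i * z i ≤ z ⬝ᵥ z :=
    Finset.single_le_sum (f := fun i => z i * z i) (fun i _ => mul_self_nonneg (z i))
      (Finset.mem_univ i)
  rw [Set.mem_ofPred_eq.mp hz] at h
  rw [Real.norm_eq_abs]
  exact abs_le_one_iff_mul_self_le_one.mpr h

/-- The quadratic function with Hessian `B` and linear term `-b`. -/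
noncomputable def quadFun (B : Matrix ι ι ℝ) (b z : ι → ℝ) : ℝ :=
  (1 / 2) * (z ⬝ᵥ (B *ᵥ z)) - b ⬝ᵥ z

lemma mulVec_dotProduct_comm {B : Matrix ι ι ℝ} (hB : B.IsSymm) (x y : ι → ℝ) :
    (B *ᵥ x) ⬝ᵥ y = x ⬝ᵥ (B *ᵥ y) := by
  rw [dotProduct_mulVec, ← mulVec_transpose, hB.eq]

lemma quadFun_expand {B : Matrix ι ι ℝ} (hB : B.IsSymm) (b x y : ι → ℝ) :
    quadFun B b y = quadFun B b x + (B *ᵥ x - b) ⬝ᵥ (y - x) +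
      (1 / 2) * ((y - x) ⬝ᵥ (B *ᵥ (y - x))) := by
  have h := mulVec_dotProduct_comm hB x y
  have h' := mulVec_dotProduct_comm hB x x
  have h2 : y ⬝ᵥ (B *ᵥ x) = x ⬝ᵥ (B *ᵥ y) := by rw [dotProduct_comm, h]
  simp only [quadFun, mulVec_sub, sub_dotProduct, dotProduct_sub]
  linarith

lemma continuous_quadFun (B : Matrix ι ι ℝ) (b : ι → ℝ) : Continuous (quadFun B b) := by
  unfold quadFun
  fun_prop

/-- Normalization to the Euclidean unit sphere. -/
noncomputable def unitize (w : ι → ℝ) : ι → ℝ := (Real.sqrt (w ⬝ᵥ w))⁻¹ • w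

lemma sqrt_dotProduct_self_pos {w : ι → ℝ} (hw : w ≠ 0) : 0 < Real.sqrt (w ⬝ᵥ w) :=
  Real.sqrt_pos.mpr (lt_of_le_of_ne (zero_le_dotProduct_self w)
    fun h => hw (dotProduct_self_eq_zero.mp h.symm))

lemma smul_unitize {w : ι → ℝ} (hw : w ≠ 0) : Real.sqrt (w ⬝ᵥ w) • unitize w = w :=
  smul_inv_smul₀ (sqrt_dotProduct_self_pos hw).ne' w

lemma unitize_dotProduct_self {w : ι → ℝ} (hw : w ≠ 0) : unitize w ⬝ᵥ unitize w = 1 := by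
  have h := sqrt_dotProduct_self_pos hw
  have h2 := Real.mul_self_sqrt (zero_le_dotProduct_self w)
  simp only [unitize, smul_dotProduct, dotProduct_smul, smul_eq_mul]
  rw [← h2, Real.sqrt_mul_self h.le]
  field_simp

lemma continuousAt_unitize {w : ι → ℝ} (hw : w ≠ 0) : ContinuousAt unitize w := by
  have h : ContinuousAt (fun w : ι → ℝ => Real.sqrt (w ⬝ᵥ w)) w := by fun_prop
  exact (h.inv₀ (sqrt_dotProduct_self_pos hw).ne').smul continuousAt_id

lemma dotProduct_sub_self {x y : ι → ℝ} (hx : x ⬝ᵥ x = 1) (hy : y ⬝ᵥ y = 1) :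
    (y - x) ⬝ᵥ (y - x) = 2 * (1 - x ⬝ᵥ y) := by
  simp only [sub_dotProduct, dotProduct_sub, hx, hy, dotProduct_comm y x]
  ring

lemma dotProduct_sub_right {x y : ι → ℝ} (hx : x ⬝ᵥ x = 1) (hy : y ⬝ᵥ y = 1) :
    x ⬝ᵥ (y - x) = -((y - x) ⬝ᵥ (y - x)) / 2 := by
  rw [dotProduct_sub_self hx hy, dotProduct_sub, hx]
  ring

/-- One projected gradient step increases a convex quadratic by at least a multiple of the squared
step length. -/
lemma quadFun_step {B : Matrix ι ι ℝ} (hB : B.IsSymm) (hpos : ∀ x, 0 ≤ x ⬝ᵥ (B *ᵥ x))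
    {b z : ι → ℝ} (hz : z ⬝ᵥ z = 1) (hw : B *ᵥ z - b ≠ 0) :
    quadFun B b z + Real.sqrt ((B *ᵥ z - b) ⬝ᵥ (B *ᵥ z - b)) / 2 *
      ((unitize (B *ᵥ z - b) - z) ⬝ᵥ (unitize (B *ᵥ z - b) - z)) ≤
      quadFun B b (unitize (B *ᵥ z - b)) := by
  rw [quadFun_expand hB b z (unitize (B *ᵥ z - b))]
  have h := hpos (unitize (B *ᵥ z - b) - z)
  have hu := unitize_dotProduct_self hw
  have e : (B *ᵥ z - b) ⬝ᵥ (unitize (B *ᵥ z - b) - z) =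
      Real.sqrt ((B *ᵥ z - b) ⬝ᵥ (B *ᵥ z - b)) / 2 *
      ((unitize (B *ᵥ z - b) - z) ⬝ᵥ (unitize (B *ᵥ z - b) - z)) := by
    have e' : ∀ q, (B *ᵥ z - b) ⬝ᵥ q =
        Real.sqrt ((B *ᵥ z - b) ⬝ᵥ (B *ᵥ z - b)) * (unitize (B *ᵥ z - b) ⬝ᵥ q) := fun q => by
      rw [← smul_eq_mul, ← smul_dotProduct, smul_unitize hw]
    rw [e', dotProduct_sub_self hz hu, dotProduct_sub (unitize (B *ᵥ z - b)), hu,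
      dotProduct_comm _ z]
    ring
  linarith

/-- Two critical points on the sphere with the same value of the quadratic have the same
multiplier. -/
lemma multiplier_eq {B : Matrix ι ι ℝ} (hB : B.IsSymm) {b x y : ι → ℝ} {s t : ℝ}
    (hx : x ⬝ᵥ x = 1) (hy : y ⬝ᵥ y = 1) (hxs : B *ᵥ x - b = s • x) (hyt : B *ᵥ y - b = t • y)
    (hxy : quadFun B b x = quadFun B b y) : s = t := by
  have h1 := quadFun_expand hB b x y
  have h2 := quadFun_expand hB b y x
  have e : (x - y) ⬝ᵥ (B *ᵥ (x - y)) = (y - x) ⬝ᵥ (B *ᵥ (y - x)) := by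
    rw [← neg_sub y x, mulVec_neg, neg_dotProduct_neg]
  have e' : (x - y) ⬝ᵥ (x - y) = (y - x) ⬝ᵥ (y - x) := by
    rw [← neg_sub y x, neg_dotProduct_neg]
  rw [hxs, smul_dotProduct, smul_eq_mul, dotProduct_sub_right hx hy] at h1
  rw [hyt, smul_dotProduct, smul_eq_mul, dotProduct_sub_right hy hx, e, e'] at h2
  have h3 : (s - t) * ((y - x) ⬝ᵥ (y - x)) = 0 := by linarith
  rcases mul_eq_zero.mp h3 with h | h
  · linarith
  · have hyx : y = x := sub_eq_zero.mp (dotProduct_self_eq_zero.mp h)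
    subst hyx
    have h4 : (s - t) * (y ⬝ᵥ y) = 0 := by
      rw [← smul_eq_mul, ← smul_dotProduct, sub_smul, ← hxs, ← hyt, sub_self, zero_dotProduct]
    rw [hx] at h4
    linarith

/-- A critical point whose multiplier dominates the Hessian is a global maximizer on the sphere. -/
lemma quadFun_le_of_multiplier {B : Matrix ι ι ℝ} (hB : B.IsSymm) {b x y : ι → ℝ} {t : ℝ}
    (hx : x ⬝ᵥ x = 1) (hy : y ⬝ᵥ y = 1) (hxt : B *ᵥ x - b = t • x)
    (ht : ∀ z, z ⬝ᵥ (B *ᵥ z) ≤ t * (z ⬝ᵥ z)) : quadFun B b y ≤ quadFun B b x := by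
  have h1 := quadFun_expand hB b x y
  rw [hxt, smul_dotProduct, smul_eq_mul, dotProduct_sub_right hx hy] at h1
  linarith [ht (y - x)]

/-- Components of a projected gradient sequence along an eigenvector orthogonal to `b`. -/
lemma dotProduct_step {B : Matrix ι ι ℝ} (hB : B.IsSymm) {b v z : ι → ℝ} {β : ℝ}
    (hv : B *ᵥ v = β • v) (hvb : v ⬝ᵥ b = 0) (hw : B *ᵥ z - b ≠ 0) :
    Real.sqrt ((B *ᵥ z - b) ⬝ᵥ (B *ᵥ z - b)) * (v ⬝ᵥ unitize (B *ᵥ z - b)) = β * (v ⬝ᵥ z) := by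
  rw [← smul_eq_mul, ← dotProduct_smul, smul_unitize hw, dotProduct_sub, hvb,
    ← mulVec_dotProduct_comm hB, hv, smul_dotProduct, smul_eq_mul, sub_zero]

theorem projectedGradient_tendsto {B : Matrix ι ι ℝ} (hB : B.IsSymm)
    (hpos : B.PosSemidef) {b v : ι → ℝ} {β : ℝ}
    (hβ : ∀ x, x ⬝ᵥ (B *ᵥ x) ≤ β * (x ⬝ᵥ x)) (hv : B *ᵥ v = β • v) (hvb : v ⬝ᵥ b = 0)
    {z : ℕ → ι → ℝ} (hz0 : z 0 ⬝ᵥ z 0 = 1) (hw : ∀ k, B *ᵥ z k - b ≠ 0)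
    (hz : ∀ k, z (k + 1) = unitize (B *ᵥ z k - b)) (hvz : v ⬝ᵥ z 0 ≠ 0) :
    ∃ x : ι → ℝ, x ⬝ᵥ x = 1 ∧ (∀ y, y ⬝ᵥ y = 1 → quadFun B b y ≤ quadFun B b x) ∧
      Tendsto z atTop (nhds x) := by
  have hnn : ∀ x, 0 ≤ x ⬝ᵥ (B *ᵥ x) := fun x => by
    simpa using hpos.dotProduct_mulVec_nonneg x
  have hβ0 : 0 ≤ β := by
    have h1 := hnn (z 0)
    have h2 := hβ (z 0)
    rw [hz0] at h2
    linarith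
  have hzu : ∀ k, z k ⬝ᵥ z k = 1
    | 0 => hz0
    | k + 1 => by rw [hz]; exact unitize_dotProduct_self (hw k)
  set τ : (ι → ℝ) → ℝ := fun x => Real.sqrt ((B *ᵥ x - b) ⬝ᵥ (B *ᵥ x - b)) with hτ
  have hτc : Continuous τ := by rw [hτ]; fun_prop
  have hwc : Continuous fun x => B *ᵥ x - b := by fun_prop
  have hτpos : ∀ k, 0 < τ (z k) := fun k => sqrt_dotProduct_self_pos (hw k)
  have hmono : Monotone fun k => quadFun B b (z k) := monotone_nat_of_le_succ fun k => by
    have h := quadFun_step hB hnn (hzu k) (hw k)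
    rw [← hz] at h
    have h1 := mul_nonneg (div_nonneg (hτpos k).le zero_le_two)
      (zero_le_dotProduct_self (z (k + 1) - z k))
    linarith
  have hlim : ∀ {x : ι → ℝ} {φ : ℕ → ℕ}, Tendsto φ atTop atTop →
      Tendsto (fun k => z (φ k)) atTop (nhds x) → Tendsto (fun k => quadFun B b (z k)) atTop
        (nhds (quadFun B b x)) := fun hφ hx =>
    (tendsto_iff_tendsto_subseq_of_monotone hmono hφ).mpr
      (((continuous_quadFun B b).tendsto _).comp hx)
  -- cluster points are critical points of the quadratic on the sphere
  have hcrit : ∀ {x : ι → ℝ} {φ : ℕ → ℕ}, Tendsto φ atTop atTop →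
      Tendsto (fun k => z (φ k)) atTop (nhds x) →
        x ⬝ᵥ x = 1 ∧ 0 < τ x ∧ B *ᵥ x - b = τ x • x := by
    intro x φ hφ hx
    have hxu : x ⬝ᵥ x = 1 :=
      isCompact_dotProduct_self_eq_one.isClosed.mem_of_tendsto hx (.of_forall fun k => hzu _)
    have hxw : B *ᵥ x - b ≠ 0 := by
      intro h
      have h1 : quadFun B b (z 0) ≤ quadFun B b x := hmono.ge_of_tendsto (hlim hφ hx) 0
      have h2 := quadFun_expand hB b x (z 0)
      rw [h, zero_dotProduct] at h2
      have h3 : (z 0 - x) ⬝ᵥ (B *ᵥ (z 0 - x)) = 0 :=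
        le_antisymm (by linarith) (hnn _)
      have h4 : B *ᵥ (z 0 - x) = 0 :=
        (hpos.dotProduct_mulVec_zero_iff _).mp (by simpa using h3)
      rw [mulVec_sub, sub_eq_zero] at h4
      exact hw 0 (h4 ▸ h)
    have hτx : 0 < τ x := sqrt_dotProduct_self_pos hxw
    have hnext : Tendsto (fun k => z (φ k + 1)) atTop (nhds (unitize (B *ᵥ x - b))) := by
      simp only [hz]
      exact (continuousAt_unitize hxw).tendsto.comp ((hwc.tendsto x).comp hx)
    have heq := tendsto_nhds_unique (hlim hφ hx)
      (hlim (tendsto_atTop_mono (fun k => Nat.le_succ _) hφ) hnext)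
    have hstep := quadFun_step hB hnn hxu hxw
    rw [← heq] at hstep
    have h0 : (unitize (B *ᵥ x - b) - x) ⬝ᵥ (unitize (B *ᵥ x - b) - x) = 0 := by
      refine le_antisymm ?_ (zero_le_dotProduct_self _)
      change quadFun B b x + τ x / 2 * _ ≤ _ at hstep
      by_contra! h
      linarith [mul_pos (half_pos hτx) h]
    have hfix : unitize (B *ᵥ x - b) = x := sub_eq_zero.mp (dotProduct_self_eq_zero.mp h0)
    refine ⟨hxu, hτx, ?_⟩
    have := smul_unitize hxw
    rw [hfix] at this
    exact this.symm
  obtain ⟨x, -, φ, hφ, hx⟩ := isCompact_dotProduct_self_eq_one.tendsto_subseq hzu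
  replace hφ := hφ.tendsto_atTop
  obtain ⟨hxu, hτx, hxτ⟩ := hcrit hφ hx
  have hτeq : ∀ {y : ι → ℝ} {ψ : ℕ → ℕ}, Tendsto ψ atTop atTop →
      Tendsto (fun k => z (ψ k)) atTop (nhds y) → τ y = τ x := by
    intro y ψ hψ hy
    obtain ⟨hyu, -, hyτ⟩ := hcrit hψ hy
    exact multiplier_eq hB hyu hxu hyτ hxτ (tendsto_nhds_unique (hlim hψ hy) (hlim hφ hx))
  have hτlim : Tendsto (fun k => τ (z k)) atTop (nhds (τ x)) := by
    refine tendsto_of_subseq_tendsto fun ψ hψ => ?_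
    obtain ⟨y, -, χ, hχ, hy⟩ :=
      isCompact_dotProduct_self_eq_one.tendsto_subseq fun k => hzu (ψ k)
    refine ⟨χ, ?_⟩
    rw [← hτeq (hψ.comp hχ.tendsto_atTop) hy]
    exact (hτc.tendsto y).comp hy
  have hβτ : β ≤ τ x := by
    by_contra! hlt
    obtain ⟨r, hr1, hr2⟩ := exists_between hlt
    have hr0 : 0 < r := hτx.trans hr1
    have hrec : ∀ k, τ (z k) * |v ⬝ᵥ z (k + 1)| = β * |v ⬝ᵥ z k| := fun k => by
      have h := dotProduct_step hB hv hvb (hw k)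
      rw [← hz] at h
      rw [← abs_of_pos (hτpos k), ← abs_mul, h, abs_mul, abs_of_nonneg hβ0]
    have hne : ∀ k, 0 < |v ⬝ᵥ z k| := by
      intro k
      induction k with
      | zero => exact abs_pos.mpr hvz
      | succ k ih =>
        exact pos_of_mul_pos_right (hrec k ▸ mul_pos (hr0.trans hr2) ih) (hτpos k).le
    obtain ⟨K, hK⟩ := eventually_atTop.mp (hτlim.eventually_lt_const hr1)
    have hgrow : ∀ j, (β / r) ^ j * |v ⬝ᵥ z K| ≤ |v ⬝ᵥ z (K + j)| := by
      intro j
      induction j with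
      | zero => simp
      | succ j ih =>
        have h1 : β * |v ⬝ᵥ z (K + j)| ≤ r * |v ⬝ᵥ z (K + j + 1)| := by
          rw [← hrec]
          exact mul_le_mul_of_nonneg_right (hK _ (Nat.le_add_right _ _)).le (abs_nonneg _)
        calc (β / r) ^ (j + 1) * |v ⬝ᵥ z K|
            = β / r * ((β / r) ^ j * |v ⬝ᵥ z K|) := by ring
          _ ≤ β / r * |v ⬝ᵥ z (K + j)| := by gcongr
          _ ≤ |v ⬝ᵥ z (K + j + 1)| := by
            rw [div_mul_eq_mul_div, div_le_iff₀ hr0]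
            linarith
    have hinf : Tendsto (fun j => (β / r) ^ j * |v ⬝ᵥ z K|) atTop atTop :=
      (tendsto_pow_atTop_atTop_of_one_lt ((one_lt_div hr0).mpr hr2)).atTop_mul_const (hne K)
    obtain ⟨j, hj⟩ := (hinf.eventually_gt_atTop (Real.sqrt (v ⬝ᵥ v))).exists
    have hbd : |v ⬝ᵥ z (K + j)| ≤ Real.sqrt (v ⬝ᵥ v) := by
      refine Real.abs_le_sqrt ?_
      simpa [hzu] using dotProduct_sq_le v (z (K + j))
    linarith [hgrow j]
  refine ⟨x, hxu, fun y hy => quadFun_le_of_multiplier hB hxu hy hxτ fun u =>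
    (hβ u).trans (mul_le_mul_of_nonneg_right hβτ (zero_le_dotProduct_self u)), ?_⟩
  refine tendsto_of_subseq_tendsto fun ψ hψ => ?_
  obtain ⟨y, -, χ, hχ, hy⟩ :=
    isCompact_dotProduct_self_eq_one.tendsto_subseq fun k => hzu (ψ k)
  refine ⟨χ, ?_⟩
  have hψχ := hψ.comp hχ.tendsto_atTop
  obtain ⟨hyu, -, hyτ⟩ := hcrit hψχ hy
  rw [hτeq hψχ hy] at hyτ
  suffices h : y = x by rw [← h]; exact hy
  by_contra hne
  set d := y - x with hd
  have hd0 : 0 < d ⬝ᵥ d := lt_of_le_of_ne (zero_le_dotProduct_self d)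
    fun h => hne (sub_eq_zero.mp (dotProduct_self_eq_zero.mp h.symm))
  have hBd : B *ᵥ d = τ x • d := by
    rw [hd, mulVec_sub, smul_sub, ← hxτ, ← hyτ]
    abel
  have hdb : d ⬝ᵥ b = 0 := by
    have h : b = B *ᵥ x - τ x • x := by rw [← hxτ]; abel
    rw [h, dotProduct_sub, ← mulVec_dotProduct_comm hB, hBd, smul_dotProduct, dotProduct_smul,
      sub_self]
  have hsign : ∀ k, ∃ s : ℝ, 0 ≤ s ∧ d ⬝ᵥ z k = s * (d ⬝ᵥ z 0) := by
    intro k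
    induction k with
    | zero => exact ⟨1, zero_le_one, (one_mul _).symm⟩
    | succ k ih =>
      obtain ⟨s, hs, hk⟩ := ih
      refine ⟨τ x / τ (z k) * s, by have := hτpos k; positivity, ?_⟩
      have h := dotProduct_step hB hBd hdb (hw k)
      rw [← hz, hk] at h
      change τ (z k) * _ = _ at h
      have := (hτpos k).ne'
      field_simp
      linarith
  have hprod : ∀ i j, 0 ≤ (d ⬝ᵥ z i) * (d ⬝ᵥ z j) := fun i j => by
    obtain ⟨s, hs, hi⟩ := hsign i
    obtain ⟨t, ht, hj⟩ := hsign j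
    rw [hi, hj, mul_mul_mul_comm]
    exact mul_nonneg (mul_nonneg hs ht) (mul_self_nonneg _)
  have hdc : Continuous fun u : ι → ℝ => d ⬝ᵥ u := by fun_prop
  have hnonneg : 0 ≤ (d ⬝ᵥ x) * (d ⬝ᵥ y) :=
    ge_of_tendsto' (((hdc.tendsto x).comp hx).mul ((hdc.tendsto y).comp hy))
      fun k => hprod _ _
  have h1 : d ⬝ᵥ x = -(d ⬝ᵥ d) / 2 := by
    rw [dotProduct_comm, hd, dotProduct_sub_right hxu hyu]
  have h2 : d ⬝ᵥ y = d ⬝ᵥ d / 2 := by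
    have : d ⬝ᵥ y - d ⬝ᵥ x = d ⬝ᵥ d := by rw [← dotProduct_sub]
    linarith
  rw [h1, h2] at hnonneg
  nlinarith

/-- A real symmetric matrix has an eigenvector realizing the minimum of its Rayleigh quotient. -/
lemma exists_min_eigenvector [Nonempty ι] [DecidableEq ι] {H : Matrix ι ι ℝ} (hH : H.IsSymm) :
    ∃ (l : ℝ) (u : ι → ℝ), u ≠ 0 ∧ H *ᵥ u = l • u ∧ ∀ x, l * (x ⬝ᵥ x) ≤ x ⬝ᵥ (H *ᵥ x) := by
  have hne : {z : ι → ℝ | z ⬝ᵥ z = 1}.Nonempty :=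
    ⟨Pi.single (Classical.arbitrary ι) 1, by simp⟩
  have hc : Continuous fun x : ι → ℝ => x ⬝ᵥ (H *ᵥ x) := by fun_prop
  obtain ⟨u, hu, hmin⟩ := isCompact_dotProduct_self_eq_one.exists_isMinOn hne hc.continuousOn
  have hu1 : u ⬝ᵥ u = 1 := hu
  set l := u ⬝ᵥ (H *ᵥ u) with hl
  have hle : ∀ x, l * (x ⬝ᵥ x) ≤ x ⬝ᵥ (H *ᵥ x) := by
    intro x
    by_cases hx : x = 0
    · simp [hx]
    have h := hmin (unitize_dotProduct_self hx)
    simp only [Set.mem_ofPred_eq] at h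
    have e := smul_unitize hx
    have hs := Real.mul_self_sqrt (zero_le_dotProduct_self x)
    set s := Real.sqrt (x ⬝ᵥ x)
    have e2 : x ⬝ᵥ (H *ᵥ x) = s * s * (unitize x ⬝ᵥ (H *ᵥ unitize x)) := by
      conv_lhs => rw [← e]
      simp only [mulVec_smul, dotProduct_smul, smul_dotProduct, smul_eq_mul]
      ring
    rw [e2, ← hs, mul_comm]
    exact mul_le_mul_of_nonneg_left h (mul_self_nonneg s)
  refine ⟨l, u, fun h => by simp [h] at hu1, ?_, hle⟩
  have hM : (H - l • (1 : Matrix ι ι ℝ)).PosSemidef := by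
    refine PosSemidef.of_dotProduct_mulVec_nonneg ?_ fun x => ?_
    · simp [IsHermitian, conjTranspose_eq_transpose_of_trivial, hH.eq]
    · have := hle x
      simp only [star_trivial, sub_mulVec, smul_mulVec, one_mulVec, dotProduct_sub,
        dotProduct_smul, smul_eq_mul]
      linarith
  have h := (hM.dotProduct_mulVec_zero_iff u).mp (by
    simp [sub_mulVec, smul_mulVec, dotProduct_sub, hu1, ← hl])
  rwa [sub_mulVec, smul_mulVec, one_mulVec, sub_eq_zero] at h

end ProjectedGradient

/-- For `H ≠ 0` symmetric with spectral norm `L` and step size `η ∈ (0, 1/L]`,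
there are finitely many nonzero vectors `v₁, …, v_m` such that for every initial
point `z⁰` on the unit sphere with `vᵢᵀz⁰ ≠ 0` for all `i`, if the (PGe2)
sequence is well-defined (i.e., `w^k ≠ 0` for all `k`), then it converges to a
global minimizer of (De). Here `A = diag(H, H)`, `a = (c, 0)`,
`f(z) = (1/2)zᵀAz + aᵀz` on `ℝ^{2n} = (Fin n ⊕ Fin n) → ℝ`, one (PGe2) step maps
`z` to `w/‖w‖` with `w = z − η(Az + a)`, and `L = ‖H‖₂` is characterized by the
quadratic-form bound together with attainment at an eigenvector. -/
theorem stmt_14 {n : ℕ} (H : Matrix (Fin n) (Fin n) ℝ) (hH : H.IsSymm) (hH0 : H ≠ 0)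
    (c : Fin n → ℝ) (L : ℝ)
    (hL1 : ∀ x : Fin n → ℝ, |x ⬝ᵥ (H *ᵥ x)| ≤ L * (x ⬝ᵥ x))
    (hL2 : ∃ v : Fin n → ℝ, v ≠ 0 ∧ (H *ᵥ v = L • v ∨ H *ᵥ v = (-L) • v))
    (η : ℝ) (hη0 : 0 < η) (hη1 : η ≤ 1 / L)
    (A : Matrix (Fin n ⊕ Fin n) (Fin n ⊕ Fin n) ℝ) (hA : A = Matrix.fromBlocks H 0 0 H)
    (a : Fin n ⊕ Fin n → ℝ) (ha : a = Sum.elim c 0)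
    (f : (Fin n ⊕ Fin n → ℝ) → ℝ)
    (hf : ∀ z, f z = (1 / 2) * (z ⬝ᵥ (A *ᵥ z)) + a ⬝ᵥ z)
    (step : (Fin n ⊕ Fin n → ℝ) → (Fin n ⊕ Fin n → ℝ))
    (hstep : ∀ z, step z =
      (Real.sqrt ((z - η • (A *ᵥ z + a)) ⬝ᵥ (z - η • (A *ᵥ z + a))))⁻¹ •
        (z - η • (A *ᵥ z + a))) :
    ∃ (m : ℕ) (v : Fin m → (Fin n ⊕ Fin n → ℝ)),
      (∀ i, v i ≠ 0) ∧
      ∀ z0 : Fin n ⊕ Fin n → ℝ, z0 ⬝ᵥ z0 = 1 →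
        (∀ i, v i ⬝ᵥ z0 ≠ 0) →
        (∀ k : ℕ, step^[k] z0 - η • (A *ᵥ (step^[k] z0) + a) ≠ 0) →
        ∃ zbar : Fin n ⊕ Fin n → ℝ, zbar ⬝ᵥ zbar = 1 ∧
          (∀ z : Fin n ⊕ Fin n → ℝ, z ⬝ᵥ z = 1 → f zbar ≤ f z) ∧
          Tendsto (fun k => step^[k] z0) atTop (nhds zbar) := by
  classical
  have hne : Nonempty (Fin n) := by
    by_contra h
    rw [not_nonempty_iff] at h
    exact hH0 (Subsingleton.elim _ _)
  have hL0 : 0 < L := one_div_pos.mp (hη0.trans_le hη1)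
  have hηL : η * L ≤ 1 := (le_div_iff₀ hL0).mp hη1
  obtain ⟨l, u, hu, hHu, hmin⟩ := exists_min_eigenvector hH
  have hAx : ∀ x y : Fin n → ℝ, A *ᵥ Sum.elim x y = Sum.elim (H *ᵥ x) (H *ᵥ y) := fun x y => by
    simp [hA, fromBlocks_mulVec]
  have hquad : ∀ z : Fin n ⊕ Fin n → ℝ, ∃ x y : Fin n → ℝ,
      z ⬝ᵥ z = x ⬝ᵥ x + y ⬝ᵥ y ∧ z ⬝ᵥ (A *ᵥ z) = x ⬝ᵥ (H *ᵥ x) + y ⬝ᵥ (H *ᵥ y) := fun z => by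
    refine ⟨z ∘ Sum.inl, z ∘ Sum.inr, ?_, ?_⟩ <;>
    · obtain ⟨x, y, rfl⟩ : ∃ x y, z = Sum.elim x y := ⟨_, _, (Sum.elim_comp_inl_inr z).symm⟩
      simp [hAx]
  set B : Matrix (Fin n ⊕ Fin n) (Fin n ⊕ Fin n) ℝ := 1 - η • A with hBdef
  have hBx : ∀ z, B *ᵥ z = z - η • (A *ᵥ z) := fun z => by
    rw [hBdef, sub_mulVec, one_mulVec, smul_mulVec]
  have hw : ∀ z, z - η • (A *ᵥ z + a) = B *ᵥ z - η • a := fun z => by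
    rw [hBx, smul_add, sub_sub]
  have hBq : ∀ z, z ⬝ᵥ (B *ᵥ z) = z ⬝ᵥ z - η * (z ⬝ᵥ (A *ᵥ z)) := fun z => by
    rw [hBx, dotProduct_sub, dotProduct_smul, smul_eq_mul]
  have hB : B.IsSymm := by
    simp [IsSymm, hBdef, hA, fromBlocks_transpose, hH.eq]
  have hpos : B.PosSemidef := by
    refine PosSemidef.of_dotProduct_mulVec_nonneg
      (by rw [IsHermitian, conjTranspose_eq_transpose_of_trivial, hB.eq]) fun z => ?_
    obtain ⟨x, y, h1, h2⟩ := hquad z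
    rw [star_trivial, hBq, h1, h2]
    have hx := mul_le_mul_of_nonneg_left (le_of_abs_le (hL1 x)) hη0.le
    have hy := mul_le_mul_of_nonneg_left (le_of_abs_le (hL1 y)) hη0.le
    have hx' := mul_le_mul_of_nonneg_right hηL (zero_le_dotProduct_self x)
    have hy' := mul_le_mul_of_nonneg_right hηL (zero_le_dotProduct_self y)
    linarith
  have hβ : ∀ z, z ⬝ᵥ (B *ᵥ z) ≤ (1 - η * l) * (z ⬝ᵥ z) := fun z => by
    obtain ⟨x, y, h1, h2⟩ := hquad z
    rw [hBq, h1, h2]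
    have hx := mul_le_mul_of_nonneg_left (hmin x) hη0.le
    have hy := mul_le_mul_of_nonneg_left (hmin y) hη0.le
    linarith
  have hv : B *ᵥ Sum.elim 0 u = (1 - η * l) • Sum.elim (0 : Fin n → ℝ) u := by
    rw [hBx, hAx, hHu, mulVec_zero]
    ext (i | i) <;> simp
    ring
  have hvb : Sum.elim (0 : Fin n → ℝ) u ⬝ᵥ (η • a) = 0 := by
    simp [ha, dotProduct_smul]
  refine ⟨1, fun _ => Sum.elim 0 u, fun _ h => hu ?_, fun z0 hz0 hvz hwk => ?_⟩
  · simpa using congrArg (fun g => g ∘ Sum.inr) h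
  obtain ⟨x, hx, hmax, hlim⟩ := projectedGradient_tendsto hB hpos hβ hv hvb
    (z := fun k => step^[k] z0) hz0 (fun k => by rw [← hw]; exact hwk k)
    (fun k => by rw [Function.iterate_succ_apply', hstep, hw]; rfl) (hvz 0)
  refine ⟨x, hx, fun z hz => ?_, hlim⟩
  have hfg : ∀ y, y ⬝ᵥ y = 1 → quadFun B (η • a) y = 1 / 2 - η * f y := fun y hy => by
    rw [quadFun, hBq, hf, hy, smul_dotProduct, smul_eq_mul]
    ring
  have h := hmax z hz
  rw [hfg z hz, hfg x hx] at h
  exact le_of_mul_le_mul_left (by linarith) hη0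
end

section
/- Let H be an n×n real symmetric matrix that is not a scalar multiple of the identity, c ∈ ℝⁿ, and τ = tr(H)/n. Then x* ∈ ℝⁿ is a global minimizer of (1/2)xᵀ(H − τI)x + cᵀx over B_n = {x : xᵀx ≤ 1} if and only if x*ᵀx* = 1 and x* is a global minimizer of q(x) = (1/2)xᵀHx + cᵀx over the unit sphere ∂B_n = {x : xᵀx = 1}. -/
open Matrix

/-- A nonzero real symmetric matrix of trace zero has a direction of negative curvature. -/
theorem Matrix.IsSymm.exists_dotProduct_mulVec_neg {ι : Type*} [Fintype ι]
    {A : Matrix ι ι ℝ} (hA : A.IsSymm) (hA0 : A ≠ 0) (htr : A.trace = 0) :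
    ∃ d : ι → ℝ, d ⬝ᵥ (A *ᵥ d) < 0 := by
  by_contra! h
  have hpsd : A.PosSemidef := Matrix.PosSemidef.of_dotProduct_mulVec_nonneg
    (by rw [Matrix.IsHermitian, Matrix.conjTranspose_eq_transpose_of_trivial]; exact hA)
    (fun x => by simpa using h x)
  exact hA0 (hpsd.trace_eq_zero_iff.mp htr)

/-- A quadratic with positive leading coefficient and negative constant term has a positive root. -/
theorem exists_pos_quadratic_root {a b e : ℝ} (ha : 0 < a) (he : e < 0) :
    ∃ t : ℝ, 0 < t ∧ a * t ^ 2 + 2 * b * t + e = 0 := by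
  have hD : b ^ 2 < b ^ 2 - a * e := by nlinarith [mul_neg_of_pos_of_neg ha he]
  have hs : b < √(b ^ 2 - a * e) := Real.lt_sqrt_of_sq_lt hD
  have hsq : √(b ^ 2 - a * e) ^ 2 = b ^ 2 - a * e :=
    Real.sq_sqrt ((sq_nonneg b).trans hD.le)
  refine ⟨(√(b ^ 2 - a * e) - b) / a, div_pos (sub_pos.mpr hs) ha, ?_⟩
  field_simp
  linear_combination hsq

/-- If `A` has a direction of negative curvature, every interior point of the unit ball is strictly
improved upon by a point of the unit sphere. -/
theorem Matrix.IsSymm.exists_sphere_lt {ι : Type*} [Fintype ι] {A : Matrix ι ι ℝ}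
    (hA : A.IsSymm) (c : ι → ℝ) {d : ι → ℝ} (hd : d ⬝ᵥ (A *ᵥ d) < 0)
    {x : ι → ℝ} (hx : x ⬝ᵥ x < 1) :
    ∃ y : ι → ℝ, y ⬝ᵥ y = 1 ∧
      (1 / 2) * (y ⬝ᵥ (A *ᵥ y)) + c ⬝ᵥ y < (1 / 2) * (x ⬝ᵥ (A *ᵥ x)) + c ⬝ᵥ x := by
  wlog hg : x ⬝ᵥ (A *ᵥ d) + c ⬝ᵥ d ≤ 0 generalizing d
  · refine this (d := -d) (by simpa [Matrix.mulVec_neg] using hd) ?_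
    simp only [Matrix.mulVec_neg, dotProduct_neg]
    linarith
  have hd0 : d ≠ 0 := by
    rintro rfl
    simp at hd
  have hdd : 0 < d ⬝ᵥ d := by
    have h0 : 0 ≤ d ⬝ᵥ d := Finset.sum_nonneg fun i _ => mul_self_nonneg (d i)
    exact h0.lt_of_ne' fun h => hd0 (dotProduct_self_eq_zero.mp h)
  obtain ⟨t, ht, hroot⟩ := exists_pos_quadratic_root (b := x ⬝ᵥ d) hdd (sub_neg.mpr hx)
  have hcomm : d ⬝ᵥ (A *ᵥ x) = x ⬝ᵥ (A *ᵥ d) := by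
    rw [dotProduct_mulVec, ← mulVec_transpose, hA.eq, dotProduct_comm]
  refine ⟨x + t • d, ?_, ?_⟩
  · simp only [add_dotProduct, dotProduct_add, smul_dotProduct, dotProduct_smul, smul_eq_mul,
      dotProduct_comm d x]
    linear_combination hroot
  · simp only [add_dotProduct, dotProduct_add, smul_dotProduct, dotProduct_smul, smul_eq_mul,
      mulVec_add, mulVec_smul, hcomm]
    have h1 := mul_nonpos_of_nonneg_of_nonpos ht.le hg
    have h2 := mul_neg_of_pos_of_neg (mul_pos ht ht) hd
    linarith

/-- For `H` symmetric and not a scalar multiple of the identity and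
`τ = tr(H)/n`, a point `x*` is a global minimizer of
`(1/2)xᵀ(H − τI)x + cᵀx` over the unit ball iff `x*ᵀx* = 1` and `x*` is a
global minimizer of `q(x) = (1/2)xᵀHx + cᵀx` over the unit sphere. -/
theorem stmt_16 {n : ℕ} (H : Matrix (Fin n) (Fin n) ℝ) (hH : H.IsSymm)
    (hns : ¬ ∃ t : ℝ, H = t • (1 : Matrix (Fin n) (Fin n) ℝ))
    (c : Fin n → ℝ) (τ : ℝ) (hτ : τ = H.trace / n)
    (p q : (Fin n → ℝ) → ℝ)
    (hp : ∀ x, p x =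
      (1 / 2) * (x ⬝ᵥ ((H - τ • (1 : Matrix (Fin n) (Fin n) ℝ)) *ᵥ x)) + c ⬝ᵥ x)
    (hq : ∀ x, q x = (1 / 2) * (x ⬝ᵥ (H *ᵥ x)) + c ⬝ᵥ x)
    (xs : Fin n → ℝ) :
    (xs ⬝ᵥ xs ≤ 1 ∧ ∀ x : Fin n → ℝ, x ⬝ᵥ x ≤ 1 → p xs ≤ p x) ↔
      (xs ⬝ᵥ xs = 1 ∧ ∀ x : Fin n → ℝ, x ⬝ᵥ x = 1 → q xs ≤ q x) := by
  have hn : (n : ℝ) ≠ 0 := by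
    rintro h
    obtain rfl : n = 0 := by exact_mod_cast h
    exact hns ⟨0, Subsingleton.elim _ _⟩
  have hA : (H - τ • (1 : Matrix (Fin n) (Fin n) ℝ)).IsSymm :=
    hH.sub (Matrix.isSymm_one.smul τ)
  obtain ⟨d, hd⟩ := hA.exists_dotProduct_mulVec_neg (fun h => hns ⟨τ, sub_eq_zero.mp h⟩) (by
    rw [trace_sub, trace_smul, trace_one, Fintype.card_fin, smul_eq_mul, hτ,
      div_mul_cancel₀ _ hn, sub_self])
  have hlt : ∀ x, x ⬝ᵥ x < 1 → ∃ y, y ⬝ᵥ y = 1 ∧ p y < p x := fun x hx => by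
    simpa only [hp] using hA.exists_sphere_lt c hd hx
  have hpq : ∀ x, x ⬝ᵥ x = 1 → p x = q x - τ / 2 := fun x hx => by
    rw [hp, hq, sub_mulVec, smul_mulVec, one_mulVec, dotProduct_sub, dotProduct_smul, hx,
      smul_eq_mul]
    ring
  constructor
  · rintro ⟨hle, hmin⟩
    have hxs : xs ⬝ᵥ xs = 1 := hle.eq_of_not_lt fun h => by
      obtain ⟨y, hy, hyx⟩ := hlt xs h
      exact (hmin y hy.le).not_gt hyx
    refine ⟨hxs, fun x hx => ?_⟩
    have := hmin x hx.le
    rw [hpq x hx, hpq xs hxs] at this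
    linarith
  · rintro ⟨hxs, hmin⟩
    have hsphere : ∀ x, x ⬝ᵥ x = 1 → p xs ≤ p x := fun x hx => by
      rw [hpq x hx, hpq xs hxs]
      linarith [hmin x hx]
    refine ⟨hxs.le, fun x hx => ?_⟩
    rcases hx.eq_or_lt with h | h
    · exact hsphere x h
    · obtain ⟨y, hy, hyx⟩ := hlt x h
      exact (hsphere y hy).trans hyx.le
end

section
/- Let H be an n×n real symmetric matrix that is not positive semidefinite and c ∈ ℝⁿ. Then every local minimizer x* of q(x) = (1/2)xᵀHx + cᵀx over B_n (i.e., a point x* ∈ B_n for which there exists ε > 0 with q(x*) ≤ q(x) for all x ∈ B_n with ‖x − x*‖ < ε) satisfies x*ᵀx* = 1. -/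
open Matrix

/-- The second-order central difference of a quadratic function in the direction `v`. -/
lemma quadratic_add_add_quadratic_sub {n : ℕ} (H : Matrix (Fin n) (Fin n) ℝ) (c x v : Fin n → ℝ) :
    ((1 / 2) * ((x + v) ⬝ᵥ (H *ᵥ (x + v))) + c ⬝ᵥ (x + v)) +
      ((1 / 2) * ((x - v) ⬝ᵥ (H *ᵥ (x - v))) + c ⬝ᵥ (x - v)) =
      2 * ((1 / 2) * (x ⬝ᵥ (H *ᵥ x)) + c ⬝ᵥ x) + v ⬝ᵥ (H *ᵥ v) := by
  simp only [mulVec_add, mulVec_sub, add_dotProduct, sub_dotProduct, dotProduct_add,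
    dotProduct_sub]
  ring

/-- If `H` is symmetric and not positive semidefinite, then every local
minimizer of `q(x) = (1/2)xᵀHx + cᵀx` over the unit ball lies on the unit
sphere. -/
theorem stmt_17 {n : ℕ} (H : Matrix (Fin n) (Fin n) ℝ) (hH : H.IsSymm)
    (hnpsd : ¬ ∀ x : Fin n → ℝ, 0 ≤ x ⬝ᵥ (H *ᵥ x))
    (c : Fin n → ℝ) (q : (Fin n → ℝ) → ℝ)
    (hq : ∀ x, q x = (1 / 2) * (x ⬝ᵥ (H *ᵥ x)) + c ⬝ᵥ x)
    (xs : Fin n → ℝ) (hxs : xs ⬝ᵥ xs ≤ 1)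
    (hloc : ∃ ε : ℝ, 0 < ε ∧ ∀ x : Fin n → ℝ, x ⬝ᵥ x ≤ 1 →
      Real.sqrt ((x - xs) ⬝ᵥ (x - xs)) < ε → q xs ≤ q x) :
    xs ⬝ᵥ xs = 1 := by
  by_contra hne
  have hlt : xs ⬝ᵥ xs < 1 := lt_of_le_of_ne hxs hne
  obtain ⟨v, hv⟩ := not_forall.mp hnpsd
  obtain ⟨ε, hε, hmin⟩ := hloc
  have hnear : ∀ᶠ x in nhds xs, q xs ≤ q x := by
    have hball : ∀ᶠ x in nhds xs, x ⬝ᵥ x < 1 :=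
      (continuous_id.dotProduct continuous_id).continuousAt.eventually_lt_const hlt
    have hdist : ∀ᶠ x in nhds xs, Real.sqrt ((x - xs) ⬝ᵥ (x - xs)) < ε := by
      have hcont : Continuous fun x : Fin n → ℝ => x - xs := by fun_prop
      exact (hcont.dotProduct hcont).sqrt.continuousAt.eventually_lt_const (by simpa using hε)
    filter_upwards [hball, hdist] with x h1 h2 using hmin x h1.le h2
  have hadd : Filter.Tendsto (fun t : ℝ => xs + t • v) (nhds 0) (nhds xs) :=
    Continuous.tendsto' (by fun_prop) _ _ (by simp)
  have hsub : Filter.Tendsto (fun t : ℝ => xs - t • v) (nhds 0) (nhds xs) :=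
    Continuous.tendsto' (by fun_prop) _ _ (by simp)
  obtain ⟨t, ⟨h1, h2⟩, ht⟩ :=
    ((((hadd.eventually hnear).and (hsub.eventually hnear)).filter_mono
      nhdsWithin_le_nhds).and (self_mem_nhdsWithin (s := Set.Ioi (0 : ℝ)))).exists
  have hdiff := quadratic_add_add_quadratic_sub H c xs (t • v)
  rw [← hq, ← hq, ← hq, mulVec_smul, smul_dotProduct, dotProduct_smul, smul_eq_mul,
    smul_eq_mul] at hdiff
  have hneg : t * (t * (v ⬝ᵥ (H *ᵥ v))) < 0 :=
    mul_neg_of_pos_of_neg ht (mul_neg_of_pos_of_neg ht (not_le.mp hv))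
  linarith
end

section
/- Let z̄ ∈ B_{2n} and λ̄ ≥ 0 satisfy (A + λ̄I)z̄ + a = 0 and λ̄(z̄ᵀz̄ − 1) = 0, and suppose λ₁ + λ̄ < 0, where λ₁ is the smallest eigenvalue of H. Then there exists a nonzero vector v ∈ ℝ^{2n} such that Av = λ₁v, vᵀz̄ = 0, and vᵀa = 0. -/
open Matrix

/-- If `z̄ ∈ B_{2n}` and `λ̄ ≥ 0` satisfy `(A + λ̄I)z̄ + a = 0` and
`λ̄(z̄ᵀz̄ − 1) = 0`, and `λ₁ + λ̄ < 0` where `λ₁` is the smallest eigenvalue of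
`H`, then there is a nonzero `v` with `Av = λ₁v`, `vᵀz̄ = 0` and `vᵀa = 0`.
Here `A = diag(H, H)` and `a = (c, 0)` on `ℝ^{2n} = (Fin n ⊕ Fin n) → ℝ`, and
`λ₁` is characterized by an eigenvector and the Rayleigh bound. -/
theorem stmt_19 {n : ℕ} (H : Matrix (Fin n) (Fin n) ℝ) (hH : H.IsSymm)
    (c : Fin n → ℝ)
    (lam1 : ℝ) (hev : ∃ v : Fin n → ℝ, v ≠ 0 ∧ H *ᵥ v = lam1 • v)
    (hray : ∀ x : Fin n → ℝ, lam1 * (x ⬝ᵥ x) ≤ x ⬝ᵥ (H *ᵥ x))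
    (A : Matrix (Fin n ⊕ Fin n) (Fin n ⊕ Fin n) ℝ) (hA : A = Matrix.fromBlocks H 0 0 H)
    (a : Fin n ⊕ Fin n → ℝ) (ha : a = Sum.elim c 0)
    (zbar : Fin n ⊕ Fin n → ℝ) (hzbar : zbar ⬝ᵥ zbar ≤ 1)
    (lambar : ℝ) (hlambar : 0 ≤ lambar)
    (h1 : (A + lambar • (1 : Matrix (Fin n ⊕ Fin n) (Fin n ⊕ Fin n) ℝ)) *ᵥ zbar + a = 0)
    (h2 : lambar * (zbar ⬝ᵥ zbar - 1) = 0)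
    (hneg : lam1 + lambar < 0) :
    ∃ v : Fin n ⊕ Fin n → ℝ, v ≠ 0 ∧ A *ᵥ v = lam1 • v ∧
      v ⬝ᵥ zbar = 0 ∧ v ⬝ᵥ a = 0 := by
  obtain ⟨u, hu0, hu⟩ := hev
  subst hA ha
  have hy : H *ᵥ (zbar ∘ Sum.inr) + lambar • (zbar ∘ Sum.inr) = 0 := by
    funext i
    have hi := congrFun h1 (Sum.inr i)
    simpa [add_mulVec, smul_mulVec, fromBlocks_mulVec] using hi
  have hsymm : u ⬝ᵥ H *ᵥ (zbar ∘ Sum.inr) = lam1 * (u ⬝ᵥ zbar ∘ Sum.inr) := by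
    rw [dotProduct_mulVec, ← mulVec_transpose, hH.eq, hu, smul_dotProduct, smul_eq_mul]
  have huy : u ⬝ᵥ (zbar ∘ Sum.inr) = 0 := by
    have h : (lam1 + lambar) * (u ⬝ᵥ zbar ∘ Sum.inr) = 0 := by
      rw [add_mul, ← hsymm, ← smul_eq_mul lambar, ← dotProduct_smul, ← dotProduct_add, hy,
        dotProduct_zero]
    exact (mul_eq_zero.mp h).resolve_left hneg.ne
  refine ⟨Sum.elim 0 u, ?_, ?_, ?_, ?_⟩
  · intro h
    exact hu0 (funext fun i => congrFun h (Sum.inr i))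
  · funext i
    cases i <;> simp [fromBlocks_mulVec, Sum.elim_comp_inr, hu]
  · simpa [dotProduct, Fintype.sum_sum_type] using huy
  · simp [dotProduct, Fintype.sum_sum_type]
end
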